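/- For each C̄ > 0 there exists a constant C_B > 0, depending only on C̄, such that the following holds. Fix z̄ = (x̄,t̄) ∈ ℝ³×ℝ and suppose u,d:Q₁(z̄)→ℝ³, p:Q₁(z̄)→ℝ have the Q₁(z̄)-regularity, satisfy ∫_{Q₁(z̄)} u·∇ψ dz = 0 for all ψ∈C_c^∞(Q₁(z̄)), and satisfy the local energy inequality on Q₁(z̄) with constants C̄ and some ρ̄∈(0,1]. Then for every z₀ ∈ Q_{1/2}(z̄), every q ∈ (5,6], every integer n ≥ 2, and every k₀ ∈ {1,…,n−1}: L_n(z₀) ≤ C_B ( (2^{α_q}−1)^{−1} max_{k₀≤k≤n} R_k(z₀) + E_{3,q}^{2/3} + (1+k₀·2^{5k₀}) E_{3,q} ), where α_q := 2(q−5)/(q−2) and E_{3,q} := ∫∫_{Q₁(z̄)} (|u|³+|∇d|³+|p|^{3/2}+|d|^q|∇d|^{3(1−q/6)}) dz. -/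

import Mathlib

open MeasureTheory Set Filter
open scoped ENNReal NNReal

noncomputable section

abbrev E3 : Type := EuclideanSpace ℝ (Fin 3)

/-- Space-time `ℝ³ × ℝ`. -/
abbrev SpT : Type := E3 × ℝ

/-- Spatial partial derivative `∂_j` of a function on space-time. -/
def sderiv (j : Fin 3) (ψ : SpT → ℝ) (z : SpT) : ℝ :=
  fderiv ℝ ψ z ((EuclideanSpace.single j 1 : E3), (0 : ℝ))

/-- Time derivative `∂_t` of a function on space-time. -/
def tderiv (ψ : SpT → ℝ) (z : SpT) : ℝ :=
  fderiv ℝ ψ z ((0 : E3), (1 : ℝ))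

/-- Spatial Laplacian of a function on space-time. -/
def sLap (ψ : SpT → ℝ) (z : SpT) : ℝ := ∑ j, sderiv j (sderiv j ψ) z

/-- `ψ ∈ C_c^∞(U)`. -/
def IsTestOn (U : Set SpT) (ψ : SpT → ℝ) : Prop :=
  ContDiff ℝ (⊤ : ℕ∞) ψ ∧ HasCompactSupport ψ ∧ tsupport ψ ⊆ U

/-- `g` is the weak spatial gradient of `f` on `U`. -/
def WeakSGrad (U : Set SpT) (f : SpT → ℝ) (g : Fin 3 → SpT → ℝ) : Prop :=
  ∀ (j : Fin 3) (ψ : SpT → ℝ), IsTestOn U ψ →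
    ∫ z in U, f z * sderiv j ψ z = - ∫ z in U, g j z * ψ z

/-- Squared Frobenius norm of a `3×3` array, e.g. `|∇v|² = Σ_{i,j} (∂_j v_i)²`. -/
def nsq2 (M : Fin 3 → Fin 3 → ℝ) : ℝ := ∑ i, ∑ j, (M i j) ^ 2

/-- Squared norm of a `3×3×3` array, e.g. `|∇²d|² = Σ_{i,j,k} (∂_j ∂_k d_i)²`. -/
def nsq3 (A : Fin 3 → Fin 3 → Fin 3 → ℝ) : ℝ := ∑ i, ∑ j, ∑ k, (A i j k) ^ 2

/-- Open Euclidean ball in `ℝ³`. -/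
def ball3 (x : E3) (r : ℝ) : Set E3 := Metric.ball x r

/-- Parabolic cylinder `Q_r(z₀) = B_r(x₀) × (t₀ - r², t₀)`. -/
def Qcyl (z : SpT) (r : ℝ) : Set SpT := ball3 z.1 r ×ˢ Ioo (z.2 - r ^ 2) z.2

/-- Centered parabolic cylinder `Q*_r(z₀) = B_r(x₀) × (t₀ - (7/8)r², t₀ + (1/8)r²)`. -/
def Qstar (z : SpT) (r : ℝ) : Set SpT :=
  ball3 z.1 r ×ˢ Ioo (z.2 - 7 / 8 * r ^ 2) (z.2 + 1 / 8 * r ^ 2)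

/-- The time interval `I*_r(t₀) = (t₀ - (7/8)r², t₀ + (1/8)r²)`. -/
def Istar (t₀ r : ℝ) : Set ℝ := Ioo (t₀ - 7 / 8 * r ^ 2) (t₀ + 1 / 8 * r ^ 2)

/-- `u` is weakly divergence free on `U`. -/
def DivFreeOn (U : Set SpT) (u : SpT → E3) : Prop :=
  ∀ ψ : SpT → ℝ, IsTestOn U ψ → ∫ z in U, ∑ j, u z j * sderiv j ψ z = 0

/-- The weak pressure equation `-Δp = ∇·(∇ᵀ·(u⊗u + ∇d⊙∇d))` on `U`. -/
def PressureEqOn (U : Set SpT) (u : SpT → E3) (p : SpT → ℝ)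
    (Dd : SpT → Fin 3 → Fin 3 → ℝ) : Prop :=
  ∀ ψ : SpT → ℝ, IsTestOn U ψ →
    -∫ z in U, p z * sLap ψ z =
      ∫ z in U, ∑ i, ∑ j, (u z i * u z j + ∑ k, Dd z k i * Dd z k j) *
        sderiv i (sderiv j ψ) z

/-- The `Q₁(z̄)`-regularity of `(u,d,p)`, with weak spatial gradients `Du`, `Dd`, `D2d`
(`Du z i j = ∂_j u_i`, `Dd z i j = ∂_j d_i`, `D2d z i j k = ∂_j ∂_k d_i`). -/
structure QReg (xb : E3) (tb : ℝ) (u d : SpT → E3) (p : SpT → ℝ)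
    (Du Dd : SpT → Fin 3 → Fin 3 → ℝ) (D2d : SpT → Fin 3 → Fin 3 → Fin 3 → ℝ) : Prop where
  meas_u : Measurable u
  meas_d : Measurable d
  meas_p : Measurable p
  meas_Du : Measurable Du
  meas_Dd : Measurable Dd
  meas_D2d : Measurable D2d
  grad_u : ∀ i : Fin 3, WeakSGrad (Qcyl (xb, tb) 1) (fun z => u z i) (fun j z => Du z i j)
  grad_d : ∀ i : Fin 3, WeakSGrad (Qcyl (xb, tb) 1) (fun z => d z i) (fun j z => Dd z i j)
  grad_Dd : ∀ i k : Fin 3,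
    WeakSGrad (Qcyl (xb, tb) 1) (fun z => Dd z i k) (fun j z => D2d z i j k)
  linf_u : ∃ M : ℝ, ∀ᵐ t ∂(volume.restrict (Ioo (tb - 1) tb)),
    ∫ x in ball3 xb 1, ‖u (x, t)‖ ^ 2 ≤ M
  linf_d : ∃ M : ℝ, ∀ᵐ t ∂(volume.restrict (Ioo (tb - 1) tb)),
    ∫ x in ball3 xb 1, ‖d (x, t)‖ ^ 2 ≤ M
  linf_Dd : ∃ M : ℝ, ∀ᵐ t ∂(volume.restrict (Ioo (tb - 1) tb)),
    ∫ x in ball3 xb 1, nsq2 (Dd (x, t)) ≤ M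
  l2_Du : IntegrableOn (fun z => nsq2 (Du z)) (Qcyl (xb, tb) 1)
  l2_Dd : IntegrableOn (fun z => nsq2 (Dd z)) (Qcyl (xb, tb) 1)
  l2_D2d : IntegrableOn (fun z => nsq3 (D2d z)) (Qcyl (xb, tb) 1)
  l32_p : IntegrableOn (fun z => |p z| ^ ((3 : ℝ) / 2)) (Qcyl (xb, tb) 1)

/-- The local energy inequality on `Q₁(z̄)` with constants `Cb` and `ρb`. -/
def LocalEnergyQ (xb : E3) (tb Cb ρb : ℝ) (u d : SpT → E3) (p : SpT → ℝ)
    (Du Dd : SpT → Fin 3 → Fin 3 → ℝ) (D2d : SpT → Fin 3 → Fin 3 → Fin 3 → ℝ) : Prop :=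
  ∀ᵐ t ∂(volume.restrict (Ioo (tb - 1) tb)), ∀ φ : SpT → ℝ,
    ContDiff ℝ (⊤ : ℕ∞) φ → HasCompactSupport φ →
    tsupport φ ⊆ ball3 xb 1 ×ˢ Ioi (tb - 1) → (∀ z, 0 ≤ φ z) →
    (∫ x in ball3 xb 1, (‖u (x, t)‖ ^ 2 + nsq2 (Dd (x, t))) * φ (x, t)) +
      (∫ τ in Ioo (tb - 1) t, ∫ x in ball3 xb 1,
        (nsq2 (Du (x, τ)) + nsq3 (D2d (x, τ))) * φ (x, τ)) ≤
    Cb * ∫ τ in Ioo (tb - 1) t,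
      ((∫ x in ball3 xb 1, ((‖u (x, τ)‖ ^ 2 + nsq2 (Dd (x, τ))) *
            |tderiv φ (x, τ) + sLap φ (x, τ)| +
          (‖u (x, τ)‖ ^ 3 + Real.sqrt (nsq2 (Dd (x, τ))) ^ 3) *
            Real.sqrt (∑ j, (sderiv j φ (x, τ)) ^ 2) +
          ρb * ‖d (x, τ)‖ ^ 2 * nsq2 (Dd (x, τ)) * φ (x, τ))) +
        abs (∫ x in ball3 xb 1, p (x, τ) * ∑ j, u (x, τ) j * sderiv j φ (x, τ)))

/-- `E_{3,q} = ∫∫_{Q₁(z̄)} (|u|³ + |∇d|³ + |p|^{3/2} + |d|^q |∇d|^{3(1−q/6)}) dz`. -/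
def E3q (xb : E3) (tb : ℝ) (u d : SpT → E3) (p : SpT → ℝ)
    (Dd : SpT → Fin 3 → Fin 3 → ℝ) (q : ℝ) : ℝ≥0∞ :=
  ∫⁻ z in Qcyl (xb, tb) 1, ENNReal.ofReal (‖u z‖ ^ 3 + Real.sqrt (nsq2 (Dd z)) ^ 3 +
    |p z| ^ ((3 : ℝ) / 2) + ‖d z‖ ^ q * Real.sqrt (nsq2 (Dd z)) ^ (3 * (1 - q / 6)))

/-- The dyadic radius `r_k = 2^{-k}`. -/
def rdy (k : ℕ) : ℝ := (1 / 2 : ℝ) ^ k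

/-- The quantity `L_k(z₀)`. -/
def Ldy (u : SpT → E3) (Du Dd : SpT → Fin 3 → Fin 3 → ℝ)
    (D2d : SpT → Fin 3 → Fin 3 → Fin 3 → ℝ) (z₀ : SpT) (k : ℕ) : ℝ≥0∞ :=
  essSup (fun t => (volume (ball3 z₀.1 (rdy k)))⁻¹ *
      ∫⁻ x in ball3 z₀.1 (rdy k), ENNReal.ofReal (‖u (x, t)‖ ^ 2 + nsq2 (Dd (x, t))))
    (volume.restrict (Ioo (z₀.2 - rdy k ^ 2) z₀.2)) +
  (volume (ball3 z₀.1 (rdy k)))⁻¹ *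
    ∫⁻ z in Qcyl z₀ (rdy k), ENNReal.ofReal (nsq2 (Du z) + nsq3 (D2d z))

/-- The quantity `R_k(z₀)`. -/
def Rdy (u : SpT → E3) (p : SpT → ℝ) (Dd : SpT → Fin 3 → Fin 3 → ℝ)
    (z₀ : SpT) (k : ℕ) : ℝ≥0∞ :=
  (volume (Qcyl z₀ (rdy k)))⁻¹ *
    ∫⁻ z in Qcyl z₀ (rdy k), ENNReal.ofReal (‖u z‖ ^ 3 + Real.sqrt (nsq2 (Dd z)) ^ 3) +
  ENNReal.ofReal (rdy k ^ ((1 : ℝ) / 3)) * ((volume (Qcyl z₀ (rdy k)))⁻¹ *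
    ∫⁻ z in Qcyl z₀ (rdy k),
      ENNReal.ofReal (‖u z‖ * abs (p z - ⨍ x in ball3 z₀.1 (rdy k), p (x, z.2))))

theorem sderiv_eq_of_hasDerivAt {ψ : SpT → ℝ} {z : SpT} {j : Fin 3} {a : ℝ}
    (hψ : DifferentiableAt ℝ ψ z)
    (h : HasDerivAt (fun t : ℝ => ψ (z.1 + t • EuclideanSpace.single j 1, z.2)) a 0) :
    sderiv j ψ z = a := by
  rw [sderiv, ← hψ.lineDeriv_eq_fderiv, lineDeriv]
  refine Eq.trans ?_ h.deriv
  congr 1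
  ext t
  congr 1
  ext <;> simp

theorem tderiv_eq_of_hasDerivAt {ψ : SpT → ℝ} {z : SpT} {a : ℝ}
    (hψ : DifferentiableAt ℝ ψ z)
    (h : HasDerivAt (fun t : ℝ => ψ (z.1, z.2 + t)) a 0) :
    tderiv ψ z = a := by
  rw [tderiv, ← hψ.lineDeriv_eq_fderiv, lineDeriv]
  refine Eq.trans ?_ h.deriv
  congr 1
  ext t
  congr 1
  ext <;> simp

theorem sderiv_mul {f g : SpT → ℝ} {z : SpT} (j : Fin 3)
    (hf : DifferentiableAt ℝ f z) (hg : DifferentiableAt ℝ g z) :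
    sderiv j (fun y => f y * g y) z = f z * sderiv j g z + g z * sderiv j f z := by
  simp [sderiv, fderiv_fun_mul hf hg]

theorem tderiv_mul {f g : SpT → ℝ} {z : SpT}
    (hf : DifferentiableAt ℝ f z) (hg : DifferentiableAt ℝ g z) :
    tderiv (fun y => f y * g y) z = f z * tderiv g z + g z * tderiv f z := by
  simp [tderiv, fderiv_fun_mul hf hg]

theorem sderiv_congr {f g : SpT → ℝ} {z : SpT} (j : Fin 3) (h : f =ᶠ[nhds z] g) :
    sderiv j f z = sderiv j g z := by
  simp only [sderiv, h.fderiv_eq]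

theorem sderiv_eventuallyEq {f g : SpT → ℝ} {z : SpT} (j : Fin 3) (h : f =ᶠ[nhds z] g) :
    sderiv j f =ᶠ[nhds z] sderiv j g := by
  filter_upwards [h.eventuallyEq_nhds] with y hy using sderiv_congr j hy

theorem tderiv_congr {f g : SpT → ℝ} {z : SpT} (h : f =ᶠ[nhds z] g) :
    tderiv f z = tderiv g z := by
  simp only [tderiv, h.fderiv_eq]

theorem sLap_congr {f g : SpT → ℝ} {z : SpT} (h : f =ᶠ[nhds z] g) :
    sLap f z = sLap g z :=
  Finset.sum_congr rfl fun j _ => sderiv_congr j (sderiv_eventuallyEq j h)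

theorem sderiv_const_zero (j : Fin 3) (c : ℝ) (z : SpT) : sderiv j (fun _ => c) z = 0 := by
  simp [sderiv]

theorem contDiffAt_sderiv {f : SpT → ℝ} {z : SpT} {m n : ℕ} (j : Fin 3)
    (hf : ContDiffAt ℝ n f z) (hmn : m + 1 ≤ n) : ContDiffAt ℝ m (sderiv j f) z := by
  have h : ContDiffAt ℝ m (fderiv ℝ f) z := hf.fderiv_right (by exact_mod_cast hmn)
  exact h.clm_apply contDiffAt_const

theorem differentiableAt_sderiv {f : SpT → ℝ} {z : SpT} (j : Fin 3)
    (hf : ContDiffAt ℝ (2 : ℕ) f z) : DifferentiableAt ℝ (sderiv j f) z :=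
  (contDiffAt_sderiv (m := 1) j hf le_rfl).differentiableAt (by norm_num)

theorem sLap_mul {f g : SpT → ℝ} {z : SpT}
    (hf : ContDiffAt ℝ (2 : ℕ) f z) (hg : ContDiffAt ℝ (2 : ℕ) g z) :
    sLap (fun y => f y * g y) z =
      f z * sLap g z + 2 * ∑ j, sderiv j f z * sderiv j g z + g z * sLap f z := by
  have h2 : ((2 : ℕ) : WithTop ℕ∞) ≠ 0 := by norm_num
  have key : ∀ j, sderiv j (sderiv j (fun y => f y * g y)) z =
      f z * sderiv j (sderiv j g) z + 2 * (sderiv j f z * sderiv j g z) +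
        g z * sderiv j (sderiv j f) z := by
    intro j
    have e : sderiv j (fun y => f y * g y) =ᶠ[nhds z]
        fun y => f y * sderiv j g y + g y * sderiv j f y := by
      filter_upwards [hf.eventually (by decide), hg.eventually (by decide)] with y h1 h2'
      exact sderiv_mul j (h1.differentiableAt h2) (h2'.differentiableAt h2)
    have df := hf.differentiableAt h2
    have dg := hg.differentiableAt h2
    have dsf := differentiableAt_sderiv j hf
    have dsg := differentiableAt_sderiv j hg
    rw [sderiv_congr j e]
    have add : sderiv j (fun y => f y * sderiv j g y + g y * sderiv j f y) z =
        sderiv j (fun y => f y * sderiv j g y) z + sderiv j (fun y => g y * sderiv j f y) z := by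
      have := fderiv_fun_add (df.fun_mul dsg) (dg.fun_mul dsf)
      simp only [sderiv] at this ⊢
      rw [this]; rfl
    rw [add, sderiv_mul j df dsg, sderiv_mul j dg dsf]
    ring
  simp only [sLap, key, Finset.sum_add_distrib, Finset.mul_sum]

theorem sderiv_translate (j : Fin 3) (ψ : SpT → ℝ) (a : SpT) :
    sderiv j (fun z => ψ (z - a)) = fun z => sderiv j ψ (z - a) := by
  ext z
  simp only [sderiv, fderiv_comp_sub]

theorem tderiv_translate (ψ : SpT → ℝ) (a z : SpT) :
    tderiv (fun z => ψ (z - a)) z = tderiv ψ (z - a) := by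
  simp only [tderiv, fderiv_comp_sub]

theorem sLap_translate (ψ : SpT → ℝ) (a z : SpT) :
    sLap (fun z => ψ (z - a)) z = sLap ψ (z - a) := by
  simp only [sLap, sderiv_translate]

/-- The backward heat kernel with pole at `(0, r²)`, up to normalization. -/
def backwardHeat (r : ℝ) (z : SpT) : ℝ :=
  (Real.sqrt (r ^ 2 - z.2))⁻¹ ^ 3 * Real.exp (-(‖z.1‖ ^ 2 / (4 * (r ^ 2 - z.2))))

theorem backwardHeat_pos {r : ℝ} {z : SpT} (hz : z.2 < r ^ 2) : 0 < backwardHeat r z := by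
  have := Real.sqrt_pos.2 (sub_pos.2 hz)
  unfold backwardHeat
  positivity

theorem contDiffAt_backwardHeat {r : ℝ} {z : SpT} (hz : z.2 < r ^ 2) {n : WithTop ℕ∞} :
    ContDiffAt ℝ n (backwardHeat r) z := by
  have hs : r ^ 2 - z.2 ≠ 0 := (sub_pos.2 hz).ne'
  have hs' : Real.sqrt (r ^ 2 - z.2) ≠ 0 := (Real.sqrt_pos.2 (sub_pos.2 hz)).ne'
  have h1 : ContDiffAt ℝ n (fun z : SpT => r ^ 2 - z.2) z := contDiffAt_const.sub contDiffAt_snd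
  have h2 : ContDiffAt ℝ n (fun z : SpT => ‖z.1‖ ^ 2) z :=
    ((contDiff_norm_sq ℝ).comp contDiff_fst).contDiffAt
  exact ((h1.sqrt hs).inv hs').pow 3 |>.mul
    ((h2.div (contDiffAt_const.mul h1) (by simpa using hs)).neg.exp)

theorem norm_add_smul_single_sq (x : E3) (j : Fin 3) (t : ℝ) :
    ‖x + t • (EuclideanSpace.single j 1 : E3)‖ ^ 2 = ‖x‖ ^ 2 + 2 * t * x j + t ^ 2 := by
  rw [norm_add_sq_real, inner_smul_right, norm_smul]
  simp [EuclideanSpace.inner_single_right]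
  ring

theorem hasDerivAt_backwardHeat_space {r : ℝ} (z : SpT) (j : Fin 3) :
    HasDerivAt (fun t : ℝ => backwardHeat r (z.1 + t • EuclideanSpace.single j 1, z.2))
      (-(z.1 j / (2 * (r ^ 2 - z.2))) * backwardHeat r z) 0 := by
  simp only [backwardHeat, norm_add_smul_single_sq]
  have h : HasDerivAt (fun t : ℝ => ‖z.1‖ ^ 2 + 2 * t * z.1 j + t ^ 2) (2 * z.1 j) 0 := by
    have := (((hasDerivAt_id (0 : ℝ)).const_mul 2).mul_const (z.1 j)).const_add (‖z.1‖ ^ 2)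
    exact (this.add ((hasDerivAt_id (0 : ℝ)).pow 2)).congr_deriv (by simp)
  refine (((h.div_const (4 * (r ^ 2 - z.2))).neg.exp).const_mul
    ((Real.sqrt (r ^ 2 - z.2))⁻¹ ^ 3)).congr_deriv ?_
  simp only [Pi.neg_apply, mul_zero, zero_mul, add_zero, ne_eq, OfNat.ofNat_ne_zero,
    not_false_eq_true, zero_pow]
  rw [div_eq_mul_inv (z.1 j), div_eq_mul_inv (2 * z.1 j), mul_inv, mul_inv]
  ring

theorem sderiv_backwardHeat {r : ℝ} {z : SpT} (hz : z.2 < r ^ 2) (j : Fin 3) :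
    sderiv j (backwardHeat r) z = -(z.1 j / (2 * (r ^ 2 - z.2))) * backwardHeat r z :=
  sderiv_eq_of_hasDerivAt ((contDiffAt_backwardHeat hz (n := 1)).differentiableAt one_ne_zero)
    (hasDerivAt_backwardHeat_space z j)

theorem tderiv_backwardHeat {r : ℝ} {z : SpT} (hz : z.2 < r ^ 2) :
    tderiv (backwardHeat r) z =
      (3 / (2 * (r ^ 2 - z.2)) - ‖z.1‖ ^ 2 / (4 * (r ^ 2 - z.2) ^ 2)) * backwardHeat r z := by
  refine tderiv_eq_of_hasDerivAt
    ((contDiffAt_backwardHeat hz (n := 1)).differentiableAt one_ne_zero) ?_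
  have hs : 0 < r ^ 2 - z.2 := sub_pos.2 hz
  have hσ := Real.sqrt_pos.2 hs
  have hsq := Real.sq_sqrt hs.le
  simp only [backwardHeat]
  have h1 : HasDerivAt (fun t : ℝ => r ^ 2 - (z.2 + t)) (-1) 0 := by
    simpa using ((hasDerivAt_id (0 : ℝ)).const_add z.2).const_sub (r ^ 2)
  have h2 := h1.sqrt (by simpa using hs.ne')
  have h3 := (h2.inv (by simpa using hσ.ne')).pow 3
  have h4 := (((h1.const_mul 4).inv (by simpa using hs.ne')).const_mul (‖z.1‖ ^ 2)).neg.exp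
  have h5 := h3.mul h4
  simp only [div_eq_mul_inv]
  refine h5.congr_deriv ?_
  simp only [Pi.pow_apply, Pi.inv_apply, Pi.neg_apply, add_zero, Nat.add_one_sub_one,
    Nat.cast_ofNat]
  set s := r ^ 2 - z.2 with hsdef
  set σ := Real.sqrt s with hσdef
  generalize Real.exp _ = e
  rw [← hsq]
  norm_num
  field_simp
  ring

theorem sderiv_sderiv_backwardHeat {r : ℝ} {z : SpT} (hz : z.2 < r ^ 2) (j : Fin 3) :
    sderiv j (sderiv j (backwardHeat r)) z =
      (z.1 j ^ 2 / (4 * (r ^ 2 - z.2) ^ 2) - 1 / (2 * (r ^ 2 - z.2))) * backwardHeat r z := by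
  refine sderiv_eq_of_hasDerivAt
    (differentiableAt_sderiv j (contDiffAt_backwardHeat hz)) ?_
  have hs : r ^ 2 - z.2 ≠ 0 := (sub_pos.2 hz).ne'
  have e : ∀ t : ℝ, sderiv j (backwardHeat r) (z.1 + t • EuclideanSpace.single j 1, z.2) =
      -((z.1 j + t) / (2 * (r ^ 2 - z.2))) *
        backwardHeat r (z.1 + t • EuclideanSpace.single j 1, z.2) := by
    intro t
    rw [sderiv_backwardHeat (by exact hz)]
    simp
  simp only [e]
  have h1 : HasDerivAt (fun t : ℝ => -((z.1 j + t) / (2 * (r ^ 2 - z.2))))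
      (-(1 / (2 * (r ^ 2 - z.2)))) 0 :=
    (((hasDerivAt_id (0 : ℝ)).const_add _).div_const _).neg
  refine (h1.mul (hasDerivAt_backwardHeat_space z j)).congr_deriv ?_
  simp only [add_zero, zero_smul, Prod.mk.eta]
  field_simp
  ring

theorem tderiv_add_sLap_backwardHeat {r : ℝ} {z : SpT} (hz : z.2 < r ^ 2) :
    tderiv (backwardHeat r) z + sLap (backwardHeat r) z = 0 := by
  have hs : r ^ 2 - z.2 ≠ 0 := (sub_pos.2 hz).ne'
  simp only [sLap, sderiv_sderiv_backwardHeat hz, tderiv_backwardHeat hz,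
    EuclideanSpace.norm_sq_eq, Fin.sum_univ_three, Real.norm_eq_abs, sq_abs]
  field_simp
  ring

theorem one_add_cube_mul_exp_neg_le {m : ℝ} (hm : 0 ≤ m) :
    (1 + m) ^ 3 * Real.exp (-m) ≤ 27 := by
  have h1 : 1 + m / 3 ≤ Real.exp (m / 3) := by linarith [Real.add_one_le_exp (m / 3)]
  have h2 : (1 + m / 3) ^ 3 ≤ Real.exp m := by
    calc (1 + m / 3) ^ 3 ≤ Real.exp (m / 3) ^ 3 := by gcongr
      _ = Real.exp m := by rw [← Real.exp_nat_mul]; congr 1; push_cast; ring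
  have h3 : (1 + m) ^ 3 ≤ 27 * (1 + m / 3) ^ 3 := by
    have : (1 + m) ^ 3 ≤ (3 * (1 + m / 3)) ^ 3 := by gcongr; linarith
    linarith [this, mul_pow 3 (1 + m / 3) 3]
  rw [Real.exp_neg, ← div_eq_mul_inv, div_le_iff₀ (Real.exp_pos m)]
  linarith

theorem backwardHeat_le {r a : ℝ} {z : SpT} (hz : z.2 < r ^ 2) (ha : 0 < a)
    (h : a ^ 2 ≤ ‖z.1‖ ^ 2 + (r ^ 2 - z.2)) : backwardHeat r z ≤ 1728 * a⁻¹ ^ 3 := by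
  have hs : 0 < r ^ 2 - z.2 := sub_pos.2 hz
  unfold backwardHeat
  set s := r ^ 2 - z.2
  set σ := Real.sqrt s with hσ
  have hσ0 : 0 < σ := Real.sqrt_pos.2 hs
  have hsq : σ ^ 2 = s := Real.sq_sqrt hs.le
  set m := ‖z.1‖ ^ 2 / (4 * s) with hm
  have hm0 : 0 ≤ m := by positivity
  have hN : ‖z.1‖ ^ 2 + s = s * (1 + 4 * m) := by rw [hm]; field_simp; ring
  have h1 : a ≤ σ * (1 + 4 * m) := by
    refine le_of_sq_le_sq ?_ (by positivity)
    rw [mul_pow, hsq]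
    rw [hN] at h
    refine h.trans ?_
    gcongr
    nlinarith
  have h2 : a ^ 3 * (σ⁻¹ ^ 3 * Real.exp (-m)) ≤ 1728 := by
    have : a ^ 3 ≤ σ ^ 3 * (1 + 4 * m) ^ 3 := by rw [← mul_pow]; gcongr
    calc a ^ 3 * (σ⁻¹ ^ 3 * Real.exp (-m))
        ≤ σ ^ 3 * (1 + 4 * m) ^ 3 * (σ⁻¹ ^ 3 * Real.exp (-m)) := by gcongr
      _ = (1 + 4 * m) ^ 3 * Real.exp (-m) := by field_simp
      _ ≤ (4 * (1 + m)) ^ 3 * Real.exp (-m) := by gcongr; linarith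
      _ = 64 * ((1 + m) ^ 3 * Real.exp (-m)) := by ring
      _ ≤ 64 * 27 := by gcongr; exact one_add_cube_mul_exp_neg_le hm0
      _ = _ := by norm_num
  rw [inv_pow a, ← div_eq_mul_inv, le_div_iff₀ (by positivity), mul_comm]
  exact h2

theorem abs_sderiv_backwardHeat_le {r a : ℝ} {z : SpT} (hz : z.2 < r ^ 2) (ha : 0 < a)
    (h : a ^ 2 ≤ ‖z.1‖ ^ 2 + (r ^ 2 - z.2)) (j : Fin 3) :
    |sderiv j (backwardHeat r) z| ≤ 432 * a⁻¹ ^ 4 := by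
  have hs : 0 < r ^ 2 - z.2 := sub_pos.2 hz
  rw [sderiv_backwardHeat hz, abs_mul, abs_neg, abs_of_pos (backwardHeat_pos hz), abs_div,
    abs_of_pos (by positivity : 0 < 2 * (r ^ 2 - z.2))]
  unfold backwardHeat
  set s := r ^ 2 - z.2
  set σ := Real.sqrt s with hσ
  have hσ0 : 0 < σ := Real.sqrt_pos.2 hs
  have hsq : σ ^ 2 = s := Real.sq_sqrt hs.le
  set m := ‖z.1‖ ^ 2 / (4 * s) with hm
  have hm0 : 0 ≤ m := by positivity
  have hN : ‖z.1‖ ^ 2 + s = s * (1 + 4 * m) := by rw [hm]; field_simp; ring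
  have hj : |z.1 j| / (2 * s) ≤ (1 + m) * σ⁻¹ := by
    have h1 : |z.1 j| ≤ ‖z.1‖ := by simpa using PiLp.norm_apply_le z.1 j
    have h2 : ‖z.1‖ ≤ 2 * σ * (1 + m) := by
      refine le_of_sq_le_sq ?_ (by positivity)
      have : ‖z.1‖ ^ 2 = 4 * s * m := by rw [hm]; field_simp
      rw [this, mul_pow, mul_pow, hsq]
      nlinarith [mul_nonneg hs.le hm0, mul_nonneg hs.le (sq_nonneg m)]
    rw [div_le_iff₀ (by positivity), ← hsq]
    calc |z.1 j| ≤ 2 * σ * (1 + m) := h1.trans h2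
      _ = (1 + m) * σ⁻¹ * (2 * σ ^ 2) := by field_simp
  have h4 : a ^ 4 ≤ (s * (1 + 4 * m)) ^ 2 := by
    rw [hN] at h
    calc a ^ 4 = (a ^ 2) ^ 2 := by ring
      _ ≤ _ := by gcongr
  rw [inv_pow a, ← div_eq_mul_inv, le_div_iff₀ (by positivity), mul_comm]
  calc a ^ 4 * (|z.1 j| / (2 * s) * (σ⁻¹ ^ 3 * Real.exp (-m)))
      ≤ (s * (1 + 4 * m)) ^ 2 * ((1 + m) * σ⁻¹ * (σ⁻¹ ^ 3 * Real.exp (-m))) := by gcongr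
    _ = (1 + 4 * m) ^ 2 * (1 + m) * Real.exp (-m) := by rw [← hsq]; field_simp
    _ ≤ (4 * (1 + m)) ^ 2 * (1 + m) * Real.exp (-m) := by gcongr; linarith
    _ = 16 * ((1 + m) ^ 3 * Real.exp (-m)) := by ring
    _ ≤ 16 * 27 := by gcongr; exact one_add_cube_mul_exp_neg_le hm0
    _ = _ := by norm_num

theorem le_backwardHeat {r : ℝ} {z : SpT} (hr : 0 < r) (hz : z ∈ Qcyl 0 r) :
    Real.exp (-1) / 8 * r⁻¹ ^ 3 ≤ backwardHeat r z := by
  obtain ⟨h1, h2, h3⟩ := hz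
  simp only [ball3, Metric.mem_ball, dist_zero_right, Prod.fst_zero, Prod.snd_zero,
    zero_sub] at h1 h2 h3
  have hs : r ^ 2 ≤ r ^ 2 - z.2 := by linarith
  have hs2 : r ^ 2 - z.2 ≤ 2 * r ^ 2 := by linarith
  have hr2 : 0 < r ^ 2 := by positivity
  unfold backwardHeat
  have hσ : Real.sqrt (r ^ 2 - z.2) ≤ 2 * r := by
    rw [Real.sqrt_le_left (by positivity)]; nlinarith
  have hσ0 : 0 < Real.sqrt (r ^ 2 - z.2) := Real.sqrt_pos.2 (by linarith)
  have hm : ‖z.1‖ ^ 2 / (4 * (r ^ 2 - z.2)) ≤ 1 := by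
    rw [div_le_one (by linarith)]
    have : ‖z.1‖ ^ 2 ≤ r ^ 2 := by gcongr
    linarith
  calc Real.exp (-1) / 8 * r⁻¹ ^ 3 = (2 * r)⁻¹ ^ 3 * Real.exp (-1) := by
        rw [mul_inv, mul_pow]; ring
    _ ≤ _ := by gcongr

theorem rdy_pos (k : ℕ) : 0 < rdy k := by unfold rdy; positivity

theorem rdy_inv (k : ℕ) : (rdy k)⁻¹ = 2 ^ k := by simp [rdy]

theorem rdy_eq (k : ℕ) : rdy k = 1 / 2 ^ k := by simp [rdy]

theorem rdy_sq (k : ℕ) : rdy k ^ 2 = 1 / 4 ^ k := by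
  rw [rdy_eq, div_pow, one_pow, ← pow_mul, mul_comm, pow_mul]; norm_num

theorem rdy_antitone : Antitone rdy := fun _ _ h =>
  pow_le_pow_of_le_one (by norm_num) (by norm_num) h

theorem mem_Qcyl_zero {z : SpT} {r : ℝ} :
    z ∈ Qcyl 0 r ↔ ‖z.1‖ < r ∧ -r ^ 2 < z.2 ∧ z.2 < 0 := by
  simp [Qcyl, ball3]

theorem Qcyl_zero_anti {k m : ℕ} (h : k ≤ m) : Qcyl 0 (rdy m) ⊆ Qcyl 0 (rdy k) := by
  intro z hz
  rw [mem_Qcyl_zero] at hz ⊢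
  have h1 := rdy_antitone h
  have h2 : rdy m ^ 2 ≤ rdy k ^ 2 := by have := rdy_pos m; gcongr
  exact ⟨hz.1.trans_le h1, by linarith, hz.2.2⟩

/-- A smooth cutoff at unit parabolic scale. -/
def parabolicCutoff (z : SpT) : ℝ :=
  Real.smoothTransition ((4 - 8 * ((‖z.1‖ ^ 2) ^ 2 + z.2 ^ 2)) / 3)

theorem contDiff_parabolicCutoff : ContDiff ℝ (⊤ : ℕ∞) parabolicCutoff := by
  have h2 : ContDiff ℝ (⊤ : ℕ∞) (fun z : SpT => ‖z.1‖ ^ 2) :=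
    (contDiff_norm_sq ℝ).comp contDiff_fst
  exact Real.smoothTransition.contDiff.comp
    ((contDiff_const.sub (contDiff_const.mul ((h2.pow 2).add (contDiff_snd.pow 2)))).div_const 3)

theorem hasCompactSupport_parabolicCutoff : HasCompactSupport parabolicCutoff := by
  refine HasCompactSupport.of_support_subset_isCompact
    (isCompact_closedBall (0 : SpT) 1) fun z hz => ?_
  by_contra hz'
  refine hz (Real.smoothTransition.zero_of_nonpos ?_)
  simp only [Metric.mem_closedBall, dist_zero_right, Prod.norm_def, sup_le_iff, not_and_or,
    not_le, Real.norm_eq_abs] at hz'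
  have : 1 ≤ (‖z.1‖ ^ 2) ^ 2 + z.2 ^ 2 := by
    rcases hz' with h | h
    · have h1 : 1 ≤ ‖z.1‖ ^ 2 := one_le_pow₀ h.le
      have := one_le_pow₀ (n := 2) h1
      nlinarith [sq_nonneg z.2]
    · have h1 : 1 ≤ |z.2| ^ 2 := one_le_pow₀ h.le
      rw [sq_abs] at h1
      nlinarith [sq_nonneg (‖z.1‖ ^ 2)]
  linarith

/-- The parabolic cutoff at scale `2^{-k}`. -/
def scaledCutoff (k : ℕ) (z : SpT) : ℝ := parabolicCutoff ((2 : ℝ) ^ k • z.1, (4 : ℝ) ^ k * z.2)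

theorem contDiff_scaledCutoff (k : ℕ) : ContDiff ℝ (⊤ : ℕ∞) (scaledCutoff k) :=
  contDiff_parabolicCutoff.comp
    ((contDiff_fst.const_smul _).prodMk (contDiff_const.mul contDiff_snd))

theorem scaledCutoff_nonneg (k : ℕ) (z : SpT) : 0 ≤ scaledCutoff k z :=
  Real.smoothTransition.nonneg _

theorem scaledCutoff_le_one (k : ℕ) (z : SpT) : scaledCutoff k z ≤ 1 :=
  Real.smoothTransition.le_one _

theorem lt_rdy_of_mem_tsupport {k : ℕ} {z : SpT} (hz : z ∈ tsupport (scaledCutoff k)) :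
    ‖z.1‖ < rdy k ∧ |z.2| < rdy k ^ 2 := by
  have hcl : IsClosed {z : SpT |
      (‖(2 : ℝ) ^ k • z.1‖ ^ 2) ^ 2 + ((4 : ℝ) ^ k * z.2) ^ 2 ≤ 1 / 2} :=
    isClosed_le (by fun_prop) continuous_const
  have hsub : tsupport (scaledCutoff k) ⊆ _ := closure_minimal (fun z hz => ?_) hcl
  · have h := hsub hz
    simp only [mem_ofPred_eq, norm_smul, norm_pow, Real.norm_ofNat] at h
    have h2 : (2 : ℝ) ^ k * ‖z.1‖ < 1 := by
      by_contra hc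
      have := one_le_pow₀ (n := 2) (one_le_pow₀ (n := 2) (not_lt.1 hc))
      nlinarith [sq_nonneg ((4 : ℝ) ^ k * z.2)]
    have h4 : (4 : ℝ) ^ k * |z.2| < 1 := by
      by_contra hc
      have := one_le_pow₀ (n := 2) (not_lt.1 hc)
      rw [mul_pow, sq_abs, ← mul_pow] at this
      nlinarith [sq_nonneg (((2 : ℝ) ^ k * ‖z.1‖) ^ 2)]
    constructor
    · rw [rdy_eq, lt_div_iff₀ (by positivity)]; linarith
    · rw [rdy_sq, lt_div_iff₀ (by positivity)]; linarith
  · by_contra hc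
    refine hz (Real.smoothTransition.zero_of_nonpos ?_)
    simp only [mem_ofPred_eq, not_le] at hc
    simp only
    linarith

theorem scaledCutoff_eventuallyEq_one {k : ℕ} {z : SpT} (hz : z ∈ Qcyl 0 (rdy (k + 1))) :
    scaledCutoff k =ᶠ[nhds z] fun _ => 1 := by
  have ho : IsOpen (Qcyl 0 (rdy (k + 1))) := Metric.isOpen_ball.prod isOpen_Ioo
  filter_upwards [ho.mem_nhds hz] with y hy
  refine Real.smoothTransition.one_of_one_le ?_
  obtain ⟨h1, h2, h3⟩ := mem_Qcyl_zero.1 hy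
  have e : rdy (k + 1) ^ 2 = 1 / 4 / 4 ^ k := by
    rw [rdy_sq, pow_succ]; field_simp
  have h4 : (2 : ℝ) ^ k * ‖y.1‖ < 1 / 2 := by
    have : rdy (k + 1) = 1 / 2 / 2 ^ k := by rw [rdy_eq, pow_succ]; field_simp
    rw [this, lt_div_iff₀ (by positivity)] at h1; linarith
  have h5 : -(1 / 4) < (4 : ℝ) ^ k * y.2 := by
    rw [e, ← neg_div, div_lt_iff₀ (by positivity)] at h2; linarith
  have h6 : (4 : ℝ) ^ k * y.2 < 0 := mul_neg_of_pos_of_neg (by positivity) h3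
  have h7 : ((4 : ℝ) ^ k * y.2) ^ 2 ≤ 1 / 16 := by nlinarith
  have h8 : ((2 : ℝ) ^ k * ‖y.1‖) ^ 2 ≤ 1 / 4 := by
    have : 0 ≤ (2 : ℝ) ^ k * ‖y.1‖ := by positivity
    nlinarith
  have h9 : (((2 : ℝ) ^ k * ‖y.1‖) ^ 2) ^ 2 ≤ 1 / 16 := by
    have : 0 ≤ ((2 : ℝ) ^ k * ‖y.1‖) ^ 2 := by positivity
    nlinarith
  simp only [norm_smul, norm_pow, Real.norm_ofNat]
  linarith

theorem sderiv_scaledCutoff (k : ℕ) (j : Fin 3) (z : SpT) :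
    sderiv j (scaledCutoff k) z =
      2 ^ k * sderiv j parabolicCutoff ((2 : ℝ) ^ k • z.1, (4 : ℝ) ^ k * z.2) := by
  let A : SpT →L[ℝ] SpT := ((2 : ℝ) ^ k • ContinuousLinearMap.fst ℝ E3 ℝ).prod
    ((4 : ℝ) ^ k • ContinuousLinearMap.snd ℝ E3 ℝ)
  have h : scaledCutoff k = parabolicCutoff ∘ A := by
    ext y; simp [scaledCutoff, A]
  have hd : DifferentiableAt ℝ parabolicCutoff (A z) :=
    contDiff_parabolicCutoff.differentiable (by simp) _
  have hA : A ((EuclideanSpace.single j 1 : E3), (0 : ℝ)) =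
      (2 : ℝ) ^ k • ((EuclideanSpace.single j 1 : E3), (0 : ℝ)) := by
    simp [A]
  rw [sderiv, h, fderiv_comp z hd A.differentiableAt, A.fderiv,
    ContinuousLinearMap.comp_apply, hA, map_smul]
  simp [sderiv, A]

theorem exists_abs_sderiv_le {ψ : SpT → ℝ} (h : ContDiff ℝ (⊤ : ℕ∞) ψ)
    (hc : HasCompactSupport ψ) : ∃ M, 0 ≤ M ∧ ∀ j z, |sderiv j ψ z| ≤ M := by
  obtain ⟨C, hC⟩ := (hc.fderiv ℝ).exists_bound_of_continuous (h.continuous_fderiv (by simp))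
  refine ⟨C, (norm_nonneg _).trans (hC 0), fun j z => ?_⟩
  have := (fderiv ℝ ψ z).le_of_opNorm_le (hC z) ((EuclideanSpace.single j 1 : E3), (0 : ℝ))
  simpa [sderiv, Prod.norm_def] using this

theorem contDiff_sderiv {ψ : SpT → ℝ} (h : ContDiff ℝ (⊤ : ℕ∞) ψ) (j : Fin 3) :
    ContDiff ℝ (⊤ : ℕ∞) (sderiv j ψ) :=
  (h.fderiv_right (m := (⊤ : ℕ∞)) (by norm_cast)).clm_apply contDiff_const

theorem contDiff_tderiv {ψ : SpT → ℝ} (h : ContDiff ℝ (⊤ : ℕ∞) ψ) :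
    ContDiff ℝ (⊤ : ℕ∞) (tderiv ψ) :=
  (h.fderiv_right (m := (⊤ : ℕ∞)) (by norm_cast)).clm_apply contDiff_const

theorem tsupport_sderiv_subset (ψ : SpT → ℝ) (j : Fin 3) :
    tsupport (sderiv j ψ) ⊆ tsupport ψ := by
  refine closure_minimal (fun z hz => ?_) (isClosed_tsupport _)
  by_contra hc
  exact hz (by simp [sderiv, fderiv_of_notMem_tsupport ℝ hc])

theorem sderiv_eq_zero_of_notMem {ψ : SpT → ℝ} {z : SpT} (hz : z ∉ tsupport ψ) (j : Fin 3) :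
    sderiv j ψ z = 0 := by
  simp [sderiv, fderiv_of_notMem_tsupport ℝ hz]

theorem tderiv_eq_zero_of_notMem {ψ : SpT → ℝ} {z : SpT} (hz : z ∉ tsupport ψ) :
    tderiv ψ z = 0 := by
  simp [tderiv, fderiv_of_notMem_tsupport ℝ hz]

theorem exists_abs_tderiv_add_sLap_le {ψ : SpT → ℝ} (h : ContDiff ℝ (⊤ : ℕ∞) ψ)
    (hc : HasCompactSupport ψ) : ∃ M, 0 ≤ M ∧ ∀ z, |tderiv ψ z + sLap ψ z| ≤ M := by
  have hcont : Continuous (fun z => tderiv ψ z + sLap ψ z) :=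
    (contDiff_tderiv h).continuous.add (continuous_finsetSum _ fun j _ =>
      (contDiff_sderiv (contDiff_sderiv h j) j).continuous)
  have hs : HasCompactSupport (fun z => tderiv ψ z + sLap ψ z) := by
    refine hc.mono' fun z hz => ?_
    by_contra hn
    refine hz ?_
    simp only [sLap, tderiv_eq_zero_of_notMem hn, zero_add]
    exact Finset.sum_eq_zero fun j _ => sderiv_eq_zero_of_notMem
      (fun hm => hn (tsupport_sderiv_subset ψ j hm)) j
  obtain ⟨C, hC⟩ := hs.exists_bound_of_continuous hcont
  exact ⟨C, (norm_nonneg _).trans (hC 0), hC⟩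

theorem hasCompactSupport_scaledCutoff (k : ℕ) : HasCompactSupport (scaledCutoff k) := by
  refine HasCompactSupport.of_support_subset_isCompact (isCompact_closedBall (0 : SpT) 1)
    fun z hz => ?_
  obtain ⟨h1, h2⟩ := lt_rdy_of_mem_tsupport (subset_closure hz)
  have h3 : rdy k ≤ 1 := by
    have := rdy_antitone (Nat.zero_le k)
    simpa [rdy] using this
  have h4 : rdy k ^ 2 ≤ 1 := pow_le_one₀ (rdy_pos k).le h3
  simp only [Metric.mem_closedBall, dist_zero_right, Prod.norm_def, sup_le_iff, Real.norm_eq_abs]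
  exact ⟨by linarith, by linarith⟩

/-- The backward heat kernel, cut off smoothly before its singular time. -/
def truncatedHeat (r : ℝ) (z : SpT) : ℝ :=
  Real.smoothTransition (1 - 2 * z.2 / r ^ 2) * backwardHeat r z

theorem truncatedHeat_eq {r : ℝ} {z : SpT} (hz : z.2 ≤ 0) :
    truncatedHeat r z = backwardHeat r z := by
  rw [truncatedHeat, Real.smoothTransition.one_of_one_le, one_mul]
  have : 2 * z.2 / r ^ 2 ≤ 0 := div_nonpos_of_nonpos_of_nonneg (by linarith) (by positivity)
  linarith

theorem truncatedHeat_eventuallyEq {r : ℝ} {z : SpT} (hz : z.2 < 0) :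
    truncatedHeat r =ᶠ[nhds z] backwardHeat r := by
  filter_upwards [(isOpen_Iio.preimage continuous_snd).mem_nhds (show z.2 ∈ Iio 0 from hz)]
    with y hy
  exact truncatedHeat_eq (le_of_lt hy)

theorem truncatedHeat_nonneg (r : ℝ) (z : SpT) : 0 ≤ truncatedHeat r z := by
  unfold truncatedHeat backwardHeat
  have := Real.smoothTransition.nonneg (1 - 2 * z.2 / r ^ 2)
  positivity

theorem contDiff_truncatedHeat {r : ℝ} (hr : 0 < r) :
    ContDiff ℝ (⊤ : ℕ∞) (truncatedHeat r) := by
  rw [contDiff_iff_contDiffAt]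
  intro z
  rcases lt_or_ge z.2 (r ^ 2) with h | h
  · refine ContDiffAt.mul ?_ (contDiffAt_backwardHeat h)
    exact (Real.smoothTransition.contDiff.comp
      (contDiff_const.sub ((contDiff_const.mul contDiff_snd).div_const _))).contDiffAt
  · have hz : z.2 ∈ Ioi (r ^ 2 / 2) := by
      have : 0 < r ^ 2 := by positivity
      simp only [mem_Ioi]; linarith
    refine (contDiffAt_const (c := (0 : ℝ))).congr_of_eventuallyEq ?_
    filter_upwards [(isOpen_Ioi.preimage continuous_snd).mem_nhds hz] with y hy
    rw [truncatedHeat, Real.smoothTransition.zero_of_nonpos, zero_mul]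
    have : r ^ 2 / 2 < y.2 := hy
    rw [sub_nonpos, le_div_iff₀ (by positivity)]
    linarith

theorem sq_le_of_notMem_Qcyl {r a : ℝ} {z : SpT} (hz : z.2 < 0) (ha : 0 ≤ a)
    (h : z ∉ Qcyl 0 a) : a ^ 2 ≤ ‖z.1‖ ^ 2 + (r ^ 2 - z.2) := by
  rw [mem_Qcyl_zero] at h
  by_cases h1 : ‖z.1‖ < a
  · have : z.2 ≤ -a ^ 2 := by by_contra hc; exact h ⟨h1, not_le.1 hc, hz⟩
    nlinarith [sq_nonneg ‖z.1‖, sq_nonneg r]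
  · have : a ^ 2 ≤ ‖z.1‖ ^ 2 := by gcongr; exact not_lt.1 h1
    nlinarith [sq_nonneg r]

theorem truncatedHeat_le {n m : ℕ} {z : SpT} (hz : z.2 < 0)
    (h : rdy m ^ 2 ≤ ‖z.1‖ ^ 2 + (rdy n ^ 2 - z.2)) :
    truncatedHeat (rdy n) z ≤ 1728 * 8 ^ m := by
  rw [truncatedHeat_eq hz.le]
  have := backwardHeat_le (hz.trans (pow_pos (rdy_pos n) 2)) (rdy_pos m) h
  rwa [rdy_inv, ← pow_mul, mul_comm m, pow_mul, show (2 : ℝ) ^ 3 = 8 by norm_num] at this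

theorem abs_sderiv_truncatedHeat_le {n m : ℕ} {z : SpT} (hz : z.2 < 0)
    (h : rdy m ^ 2 ≤ ‖z.1‖ ^ 2 + (rdy n ^ 2 - z.2)) (j : Fin 3) :
    |sderiv j (truncatedHeat (rdy n)) z| ≤ 432 * 16 ^ m := by
  rw [sderiv_congr j (truncatedHeat_eventuallyEq hz)]
  have := abs_sderiv_backwardHeat_le (hz.trans (pow_pos (rdy_pos n) 2)) (rdy_pos m) h j
  rwa [rdy_inv, ← pow_mul, mul_comm m, pow_mul, show (2 : ℝ) ^ 4 = 16 by norm_num] at this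

theorem rdy_sq_le_self {n : ℕ} {z : SpT} (hz : z.2 < 0) :
    rdy n ^ 2 ≤ ‖z.1‖ ^ 2 + (rdy n ^ 2 - z.2) := by
  nlinarith [sq_nonneg ‖z.1‖]

theorem exists_last_mem_Qcyl {n : ℕ} (hn : 1 ≤ n) {z : SpT} (hz : z ∈ Qcyl 0 (rdy 1)) :
    ∃ k ∈ Finset.Icc 1 n, z ∈ Qcyl 0 (rdy k) ∧ (k = n ∨ z ∉ Qcyl 0 (rdy (k + 1))) := by
  induction n, hn using Nat.le_induction with
  | base => exact ⟨1, by simp, hz, Or.inl rfl⟩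
  | succ m hm ih =>
    obtain ⟨k, hk, hzk, h⟩ := ih
    rw [Finset.mem_Icc] at hk
    rcases h with rfl | h
    · by_cases hs : z ∈ Qcyl 0 (rdy (k + 1))
      · exact ⟨k + 1, by simp, hs, Or.inl rfl⟩
      · exact ⟨k, by simp; omega, hzk, Or.inr hs⟩
    · exact ⟨k, by simp; omega, hzk, Or.inr h⟩

/-- The part at scale `2^{-k}` of the cut-off heat kernel. -/
def dyadicPiece (n k : ℕ) (z : SpT) : ℝ :=
  (scaledCutoff k z - if k < n then scaledCutoff (k + 1) z else 0) * truncatedHeat (rdy n) z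

theorem sum_dyadicPiece {n : ℕ} (hn : 1 ≤ n) (z : SpT) :
    ∑ k ∈ Finset.Icc 1 n, dyadicPiece n k z = scaledCutoff 1 z * truncatedHeat (rdy n) z := by
  have key : ∀ m, 1 ≤ m → m ≤ n → ∑ k ∈ Finset.Icc 1 m, dyadicPiece n k z =
      (scaledCutoff 1 z - if m < n then scaledCutoff (m + 1) z else 0) *
        truncatedHeat (rdy n) z := by
    intro m hm
    induction m, hm using Nat.le_induction with
    | base => intro _; simp [dyadicPiece]
    | succ m hm ih =>
      intro h
      rw [Finset.sum_Icc_succ_top (by omega), ih (by omega), dyadicPiece,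
        if_pos (show m < n by omega)]
      ring
  simpa using key n hn le_rfl

theorem contDiff_dyadicPiece (n k : ℕ) : ContDiff ℝ (⊤ : ℕ∞) (dyadicPiece n k) := by
  refine ContDiff.mul ?_ (contDiff_truncatedHeat (rdy_pos n))
  split_ifs
  · exact (contDiff_scaledCutoff k).sub (contDiff_scaledCutoff (k + 1))
  · simpa using contDiff_scaledCutoff k

theorem lt_rdy_of_mem_tsupport_dyadicPiece {n k : ℕ} {z : SpT}
    (hz : z ∈ tsupport (dyadicPiece n k)) : ‖z.1‖ < rdy k ∧ |z.2| < rdy k ^ 2 := by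
  have hsub : tsupport (dyadicPiece n k) ⊆
      tsupport (scaledCutoff k) ∪ tsupport (scaledCutoff (k + 1)) := by
    refine closure_minimal (fun y hy => ?_) ((isClosed_tsupport _).union (isClosed_tsupport _))
    by_contra hc
    rw [mem_union, not_or] at hc
    refine hy ?_
    simp [dyadicPiece, image_eq_zero_of_notMem_tsupport hc.1,
      image_eq_zero_of_notMem_tsupport hc.2]
  rcases hsub hz with h | h
  · exact lt_rdy_of_mem_tsupport h
  · obtain ⟨h1, h2⟩ := lt_rdy_of_mem_tsupport h
    have h3 := rdy_antitone (Nat.le_succ k)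
    have h4 : rdy (k + 1) ^ 2 ≤ rdy k ^ 2 := by have := rdy_pos (k + 1); gcongr
    exact ⟨h1.trans_le h3, h2.trans_le h4⟩

theorem hasCompactSupport_dyadicPiece (n k : ℕ) : HasCompactSupport (dyadicPiece n k) := by
  refine HasCompactSupport.mul_right ?_
  refine (hasCompactSupport_scaledCutoff k).sub ?_
  split_ifs
  · exact hasCompactSupport_scaledCutoff (k + 1)
  · exact HasCompactSupport.zero

theorem abs_sderiv_dyadicPiece_le {M : ℝ} (hM : 0 ≤ M)
    (hX : ∀ j z, |sderiv j parabolicCutoff z| ≤ M) {n k : ℕ} (hk : k ≤ n) {z : SpT}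
    (hz : z.2 < 0) (j : Fin 3) :
    |sderiv j (dyadicPiece n k) z| ≤ (331776 * M + 110592) * 16 ^ k := by
  have hG : DifferentiableAt ℝ (truncatedHeat (rdy n)) z :=
    (contDiff_truncatedHeat (rdy_pos n)).differentiable (by simp) z
  have hd : ∀ m, DifferentiableAt ℝ (scaledCutoff m) z := fun m =>
    (contDiff_scaledCutoff m).differentiable (by simp) z
  have hS : ∀ m, |sderiv j (scaledCutoff m) z| ≤ 2 ^ m * M := by
    intro m
    rw [sderiv_scaledCutoff, abs_mul, abs_of_pos (by positivity : (0 : ℝ) < 2 ^ m)]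
    gcongr
    exact hX _ _
  have hG0 := truncatedHeat_nonneg (rdy n) z
  have h16 : (0 : ℝ) < 16 ^ k := by positivity
  have e16 : (2 : ℝ) ^ k * 8 ^ k = 16 ^ k := by rw [← mul_pow]; norm_num
  rcases hk.lt_or_eq with hlt | rfl
  · have hfun : dyadicPiece n k =
        fun y => (scaledCutoff k y - scaledCutoff (k + 1) y) * truncatedHeat (rdy n) y := by
      ext y; simp [dyadicPiece, hlt]
    have hsub : sderiv j (fun y => scaledCutoff k y - scaledCutoff (k + 1) y) z =
        sderiv j (scaledCutoff k) z - sderiv j (scaledCutoff (k + 1)) z := by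
      simp only [sderiv]
      rw [fderiv_fun_sub (hd k) (hd (k + 1))]; rfl
    by_cases hin : z ∈ Qcyl 0 (rdy (k + 2))
    · have h1 := scaledCutoff_eventuallyEq_one (Qcyl_zero_anti (Nat.le_succ (k + 1)) hin)
      have h2 := scaledCutoff_eventuallyEq_one (k := k + 1) hin
      have : dyadicPiece n k =ᶠ[nhds z] fun _ => 0 := by
        rw [hfun]
        filter_upwards [h1, h2] with y e1 e2
        rw [e1, e2]; ring
      rw [sderiv_congr j this, sderiv_const_zero, abs_zero]
      positivity
    · have hw := sq_le_of_notMem_Qcyl (r := rdy n) hz (rdy_pos (k + 2)).le hin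
      have b1 := truncatedHeat_le hz hw
      have b2 := abs_sderiv_truncatedHeat_le hz hw j
      rw [hfun, sderiv_mul j ((hd k).fun_sub (hd (k + 1))) hG, hsub]
      have c1 : |scaledCutoff k z - scaledCutoff (k + 1) z| ≤ 1 := by
        rw [abs_le]
        constructor <;> linarith [scaledCutoff_nonneg k z, scaledCutoff_nonneg (k + 1) z,
          scaledCutoff_le_one k z, scaledCutoff_le_one (k + 1) z]
      have c2 : |sderiv j (scaledCutoff k) z - sderiv j (scaledCutoff (k + 1)) z| ≤
          3 * 2 ^ k * M := by
        refine (abs_sub _ _).trans ((add_le_add (hS k) (hS (k + 1))).trans_eq ?_)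
        ring
      refine (abs_add_le _ _).trans ?_
      rw [abs_mul, abs_mul, abs_of_nonneg hG0]
      calc _ ≤ 1 * (432 * 16 ^ (k + 2)) + 1728 * 8 ^ (k + 2) * (3 * 2 ^ k * M) := by gcongr
        _ = (331776 * M + 110592) * 16 ^ k := by rw [← e16, pow_add 16, ← e16]; ring
  · have hfun : dyadicPiece k k = fun y => scaledCutoff k y * truncatedHeat (rdy k) y := by
      ext y; simp [dyadicPiece]
    have hw := rdy_sq_le_self (n := k) hz
    have b1 := truncatedHeat_le hz hw
    have b2 := abs_sderiv_truncatedHeat_le hz hw j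
    rw [hfun, sderiv_mul j (hd k) hG]
    have c1 : |scaledCutoff k z| ≤ 1 := by
      rw [abs_of_nonneg (scaledCutoff_nonneg k z)]; exact scaledCutoff_le_one k z
    refine (abs_add_le _ _).trans ?_
    rw [abs_mul, abs_mul, abs_of_nonneg hG0]
    calc _ ≤ 1 * (432 * 16 ^ k) + 1728 * 8 ^ k * (2 ^ k * M) := by
          have := hS k; gcongr
      _ = (1728 * M + 432) * 16 ^ k := by rw [← e16]; ring
      _ ≤ _ := by gcongr <;> norm_num

theorem exists_test_functions : ∃ C : ℝ, 0 < C ∧ ∃ c : ℝ, 0 < c ∧ ∀ n : ℕ, 2 ≤ n →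
    ∃ (φ : SpT → ℝ) (η : ℕ → SpT → ℝ),
      (ContDiff ℝ (⊤ : ℕ∞) φ ∧ HasCompactSupport φ ∧
        tsupport φ ⊆ ball3 0 (1 / 2) ×ˢ Ioi (-(1 / 4))) ∧
      (∀ z, 0 ≤ φ z) ∧
      (∀ z ∈ Qcyl 0 (rdy n), c * 8 ^ n ≤ φ z) ∧
      (∀ z : SpT, z.2 < 0 → |tderiv φ z + sLap φ z| ≤ C) ∧
      (∀ z : SpT, z.2 < 0 → φ z ≠ 0 →
        ∃ k ∈ Finset.Icc 1 n, z ∈ Qcyl 0 (rdy k) ∧ φ z ≤ C * 8 ^ k) ∧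
      (∀ z, φ z = ∑ k ∈ Finset.Icc 1 n, η k z) ∧
      (∀ k ∈ Finset.Icc 1 n, ContDiff ℝ (⊤ : ℕ∞) (η k) ∧ HasCompactSupport (η k) ∧
        tsupport (η k) ⊆ ball3 0 (1 / 2) ×ˢ Ioi (-(1 / 4))) ∧
      (∀ k ∈ Finset.Icc 1 n, ∀ z : SpT, z.2 < 0 → z ∉ Qcyl 0 (rdy k) →
        ∀ j, sderiv j (η k) z = 0) ∧
      (∀ k ∈ Finset.Icc 1 n, ∀ z : SpT, z.2 < 0 → ∀ j, |sderiv j (η k) z| ≤ C * 16 ^ k) := by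
  obtain ⟨M, hM, hX⟩ := exists_abs_sderiv_le contDiff_parabolicCutoff
    hasCompactSupport_parabolicCutoff
  obtain ⟨M', hM', hX'⟩ := exists_abs_tderiv_add_sLap_le (contDiff_scaledCutoff 1)
    (hasCompactSupport_scaledCutoff 1)
  have hr1 : rdy 1 = 1 / 2 := by norm_num [rdy]
  have box : ∀ {k : ℕ} {z : SpT}, 1 ≤ k → (‖z.1‖ < rdy k ∧ |z.2| < rdy k ^ 2) →
      z ∈ ball3 0 (1 / 2) ×ˢ Ioi (-(1 / 4 : ℝ)) := by
    intro k z hk h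
    have h3 := rdy_antitone hk
    have h4 : rdy k ^ 2 ≤ rdy 1 ^ 2 := by have := rdy_pos k; gcongr
    rw [hr1] at h3 h4
    refine ⟨by simpa [ball3] using h.1.trans_le h3, ?_⟩
    have := (abs_lt.1 h.2).1
    simp only [mem_Ioi]
    linarith
  refine ⟨331776 * M + 110592 + 110592 * M' + 20736 * 100 * (M + 1), by positivity,
    Real.exp (-1) / 8, by positivity, fun n hn => ?_⟩
  refine ⟨fun z => scaledCutoff 1 z * truncatedHeat (rdy n) z, dyadicPiece n, ⟨?_, ?_, ?_⟩,
    ?_, ?_, ?_, ?_, fun z => (sum_dyadicPiece (by omega) z).symm, ?_, ?_, ?_⟩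
  · exact (contDiff_scaledCutoff 1).mul (contDiff_truncatedHeat (rdy_pos n))
  · exact (hasCompactSupport_scaledCutoff 1).mul_right
  · exact fun z hz => box le_rfl (lt_rdy_of_mem_tsupport (tsupport_mul_subset_left hz))
  · exact fun z => mul_nonneg (scaledCutoff_nonneg _ _) (truncatedHeat_nonneg _ _)
  · intro z hz
    have h1 := (scaledCutoff_eventuallyEq_one (k := 1) (Qcyl_zero_anti hn hz)).self_of_nhds
    have h2 := le_backwardHeat (rdy_pos n) hz
    rw [rdy_inv, ← pow_mul, mul_comm n, pow_mul, show (2 : ℝ) ^ 3 = 8 by norm_num] at h2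
    simp only
    rw [h1, one_mul, truncatedHeat_eq (mem_Qcyl_zero.1 hz).2.2.le]
    exact h2
  · intro z hz
    have hz' : z.2 < rdy n ^ 2 := hz.trans (pow_pos (rdy_pos n) 2)
    have e : (fun z => scaledCutoff 1 z * truncatedHeat (rdy n) z) =ᶠ[nhds z]
        fun z => scaledCutoff 1 z * backwardHeat (rdy n) z := by
      filter_upwards [truncatedHeat_eventuallyEq hz] with y hy
      rw [hy]
    have hc : ContDiffAt ℝ (2 : ℕ) (scaledCutoff 1) z :=
      ((contDiff_scaledCutoff 1).of_le (by exact WithTop.coe_le_coe.2 le_top)).contDiffAt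
    have hb : ContDiffAt ℝ (2 : ℕ) (backwardHeat (rdy n)) z := contDiffAt_backwardHeat hz'
    have heat := tderiv_add_sLap_backwardHeat hz'
    by_cases hin : z ∈ Qcyl 0 (rdy 2)
    · have e2 : (fun z => scaledCutoff 1 z * truncatedHeat (rdy n) z) =ᶠ[nhds z]
          backwardHeat (rdy n) := by
        filter_upwards [e, scaledCutoff_eventuallyEq_one (k := 1) hin] with y h1 h2
        rw [h1, h2, one_mul]
      rw [tderiv_congr e2, sLap_congr e2, heat, abs_zero]
      positivity
    · have hw := sq_le_of_notMem_Qcyl (r := rdy n) hz (rdy_pos 2).le hin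
      have b1 := truncatedHeat_le hz hw
      have b0 := truncatedHeat_nonneg (rdy n) z
      rw [truncatedHeat_eq hz.le] at b1 b0
      have b2 := fun j => abs_sderiv_truncatedHeat_le hz hw j
      simp only [sderiv_congr _ (truncatedHeat_eventuallyEq hz)] at b2
      rw [tderiv_congr e, sLap_congr e, sLap_mul hc hb, tderiv_mul
        (hc.differentiableAt (by norm_num)) (hb.differentiableAt (by norm_num))]
      have : scaledCutoff 1 z * tderiv (backwardHeat (rdy n)) z +
          backwardHeat (rdy n) z * tderiv (scaledCutoff 1) z +
          (scaledCutoff 1 z * sLap (backwardHeat (rdy n)) z +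
            2 * ∑ j, sderiv j (scaledCutoff 1) z * sderiv j (backwardHeat (rdy n)) z +
            backwardHeat (rdy n) z * sLap (scaledCutoff 1) z) =
          backwardHeat (rdy n) z * (tderiv (scaledCutoff 1) z + sLap (scaledCutoff 1) z) +
            2 * ∑ j, sderiv j (scaledCutoff 1) z * sderiv j (backwardHeat (rdy n)) z := by
        linear_combination scaledCutoff 1 z * heat
      rw [this]
      refine (abs_add_le _ _).trans ?_
      rw [abs_mul, abs_mul, abs_of_nonneg b0, abs_two]
      have hsum : |∑ j, sderiv j (scaledCutoff 1) z * sderiv j (backwardHeat (rdy n)) z| ≤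
          3 * ((2 * M) * (432 * 16 ^ 2)) := by
        refine (Finset.abs_sum_le_sum_abs _ _).trans ?_
        refine (Finset.sum_le_card_nsmul _ _ ((2 * M) * (432 * 16 ^ 2)) fun j _ => ?_).trans ?_
        · rw [abs_mul]
          have h1 : |sderiv j (scaledCutoff 1) z| ≤ 2 * M := by
            rw [sderiv_scaledCutoff, abs_mul]
            norm_num
            exact hX _ _
          have := b2 j
          gcongr
        · simp
      calc _ ≤ 1728 * 8 ^ 2 * M' + 2 * (3 * ((2 * M) * (432 * 16 ^ 2))) := by
            have := hX' z; gcongr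
        _ ≤ _ := by nlinarith
  · intro z hz hne
    have hQ : z ∈ Qcyl 0 (rdy 1) := by
      have h := lt_rdy_of_mem_tsupport (k := 1) (z := z)
        (subset_closure (fun h0 => hne (by simp [h0])))
      exact mem_Qcyl_zero.2 ⟨h.1, (abs_lt.1 h.2).1, hz⟩
    obtain ⟨k, hk, hzk, h⟩ := exists_last_mem_Qcyl (by omega : 1 ≤ n) hQ
    refine ⟨k, hk, hzk, ?_⟩
    have hG : truncatedHeat (rdy n) z ≤ 1728 * 8 ^ (k + 1) := by
      rcases h with rfl | h
      · refine (truncatedHeat_le hz (rdy_sq_le_self hz)).trans ?_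
        gcongr <;> norm_num
      · exact truncatedHeat_le hz (sq_le_of_notMem_Qcyl hz (rdy_pos _).le h)
    calc scaledCutoff 1 z * truncatedHeat (rdy n) z ≤ 1 * (1728 * 8 ^ (k + 1)) :=
          mul_le_mul (scaledCutoff_le_one _ _) hG (truncatedHeat_nonneg _ _) zero_le_one
      _ = 13824 * 8 ^ k := by ring
      _ ≤ _ := by gcongr; nlinarith
  · intro k hk
    exact ⟨contDiff_dyadicPiece n k, hasCompactSupport_dyadicPiece n k, fun z hz =>
      box (Finset.mem_Icc.1 hk).1 (lt_rdy_of_mem_tsupport_dyadicPiece hz)⟩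
  · intro k _ z hz hout j
    refine sderiv_eq_zero_of_notMem (fun hmem => hout ?_) j
    have h := lt_rdy_of_mem_tsupport_dyadicPiece hmem
    exact mem_Qcyl_zero.2 ⟨h.1, (abs_lt.1 h.2).1, hz⟩
  · intro k hk z hz j
    refine (abs_sderiv_dyadicPiece_le hM hX (Finset.mem_Icc.1 hk).2 hz j).trans ?_
    refine mul_le_mul_of_nonneg_right ?_ (by positivity)
    nlinarith

theorem isOpen_Qcyl (z : SpT) (r : ℝ) : IsOpen (Qcyl z r) := Metric.isOpen_ball.prod isOpen_Ioo

theorem volume_restrict_Qcyl_one (xb : E3) (tb : ℝ) :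
    (volume : Measure SpT).restrict (Qcyl (xb, tb) 1) =
      ((volume : Measure E3).restrict (ball3 xb 1)).prod (volume.restrict (Ioo (tb - 1) tb)) := by
  rw [Measure.prod_restrict, ← Measure.volume_eq_prod]
  simp [Qcyl]

theorem abs_sum_mul_le (v : E3) (a : Fin 3 → ℝ) {K : ℝ} (ha : ∀ j, |a j| ≤ K) :
    |∑ j, v j * a j| ≤ ‖v‖ * (3 * K) := by
  refine (Finset.abs_sum_le_sum_abs _ _).trans ?_
  refine (Finset.sum_le_card_nsmul _ _ (‖v‖ * K) fun j _ => ?_).trans_eq (by simp; ring)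
  rw [abs_mul]
  have : |v j| ≤ ‖v‖ := by simpa using PiLp.norm_apply_le v j
  have := ha j
  gcongr

theorem measurable_sum_mul_sderiv {u : SpT → E3} (hu : Measurable u) {η : SpT → ℝ}
    (hη : ContDiff ℝ (⊤ : ℕ∞) η) : Measurable fun z => ∑ j, u z j * sderiv j η z :=
  Finset.measurable_sum _ fun j _ => ((EuclideanSpace.proj (𝕜 := ℝ) j).continuous.measurable.comp
    hu).mul (contDiff_sderiv hη j).continuous.measurable

theorem ae_slice_divFree {xb : E3} {tb : ℝ} {u : SpT → E3} (hu : Measurable u)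
    (hui : IntegrableOn u (Qcyl (xb, tb) 1)) (hdiv : DivFreeOn (Qcyl (xb, tb) 1) u)
    {η : SpT → ℝ} (hη : ContDiff ℝ (⊤ : ℕ∞) η) (hηc : HasCompactSupport η)
    (hηs : tsupport η ⊆ ball3 xb 1 ×ˢ univ) :
    ∀ᵐ τ ∂(volume.restrict (Ioo (tb - 1) tb)),
      ∫ x in ball3 xb 1, ∑ j, u (x, τ) j * sderiv j η (x, τ) = 0 := by
  obtain ⟨M, -, hMb⟩ := exists_abs_sderiv_le hη hηc
  have hmeas := measurable_sum_mul_sderiv hu hη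
  have hint : IntegrableOn (fun z => ∑ j, u z j * sderiv j η z) (Qcyl (xb, tb) 1) := by
    refine Integrable.mono' (hui.norm.mul_const (3 * M)) hmeas.aestronglyMeasurable ?_
    filter_upwards with z using abs_sum_mul_le _ _ fun j => hMb j z
  rw [IntegrableOn, volume_restrict_Qcyl_one] at hint
  have hloc : LocallyIntegrableOn
      (fun τ => ∫ x in ball3 xb 1, ∑ j, u (x, τ) j * sderiv j η (x, τ)) (Ioo (tb - 1) tb)
      (volume.restrict (Ioo (tb - 1) tb)) :=
    hint.integral_prod_right.integrableOn.locallyIntegrableOn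
  have := isOpen_Ioo.ae_eq_zero_of_integral_contDiff_smul_eq_zero hloc fun θ hθ hθc hθs => ?_
  · filter_upwards [this, ae_restrict_mem measurableSet_Ioo] with τ h1 h2 using h1 h2
  obtain ⟨Mθ, hMθ⟩ := hθc.exists_bound_of_continuous hθ.continuous
  set ψ : SpT → ℝ := fun z => θ z.2 * η z with hψ
  have hψd : ContDiff ℝ (⊤ : ℕ∞) ψ := (hθ.comp contDiff_snd).mul hη
  have hψs : tsupport ψ ⊆ Qcyl (xb, tb) 1 := by
    intro z hz
    have h1 : z ∈ tsupport η := tsupport_mul_subset_right hz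
    have h2 : z.2 ∈ tsupport θ := by
      have hcl : IsClosed (Prod.snd ⁻¹' tsupport θ : Set SpT) :=
        (isClosed_tsupport θ).preimage continuous_snd
      refine closure_minimal (fun y hy => ?_) hcl hz
      exact subset_closure fun h0 => hy (by simp [hψ, h0])
    have h3 := hθs h2
    refine ⟨(hηs h1).1, ?_⟩
    simpa using h3
  have hψderiv : ∀ (j : Fin 3) (z : SpT), sderiv j ψ z = θ z.2 * sderiv j η z := by
    intro j z
    have hd1 : DifferentiableAt ℝ θ z.2 := hθ.differentiable (by simp) _
    have hd2 : DifferentiableAt ℝ (fun z : SpT => θ z.2) z :=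
      (hθ.comp contDiff_snd).differentiable (by simp) z
    have h0 : sderiv j (fun z : SpT => θ z.2) z = 0 := by
      refine sderiv_eq_of_hasDerivAt hd2 ?_
      exact hasDerivAt_const (0 : ℝ) (θ z.2)
    rw [hψ, sderiv_mul j hd2 (hη.differentiable (by simp) z), h0]
    ring
  have h0 := hdiv ψ ⟨hψd, hηc.mul_left, hψs⟩
  rw [volume_restrict_Qcyl_one] at h0
  have e : ∀ z, ∑ j, u z j * sderiv j ψ z = θ z.2 * ∑ j, u z j * sderiv j η z := by
    intro z
    rw [Finset.mul_sum]
    exact Finset.sum_congr rfl fun j _ => by rw [hψderiv]; ring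
  simp only [e] at h0
  have hint2 : Integrable (fun z : SpT => θ z.2 * ∑ j, u z j * sderiv j η z)
      (((volume : Measure E3).restrict (ball3 xb 1)).prod
        (volume.restrict (Ioo (tb - 1) tb))) := by
    refine hint.bdd_mul (c := Mθ) ?_ ?_
    · exact (hθ.continuous.comp continuous_snd).aestronglyMeasurable
    · exact Eventually.of_forall fun z => hMθ z.2
  rw [integral_prod_symm _ hint2] at h0
  simpa only [smul_eq_mul, integral_const_mul] using h0

theorem ae_slice_pressure_eq {xb : E3} {tb : ℝ} {u : SpT → E3} {p : SpT → ℝ}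
    (hu : Measurable u) (hp : Measurable p)
    (hui : IntegrableOn u (Qcyl (xb, tb) 1))
    (hpu : IntegrableOn (fun z => |p z| * ‖u z‖) (Qcyl (xb, tb) 1))
    (hdiv : DivFreeOn (Qcyl (xb, tb) 1) u)
    {η : SpT → ℝ} (hη : ContDiff ℝ (⊤ : ℕ∞) η) (hηc : HasCompactSupport η)
    (hηs : tsupport η ⊆ ball3 xb 1 ×ˢ univ) :
    ∀ᵐ τ ∂(volume.restrict (Ioo (tb - 1) tb)),
      Integrable (fun x => p (x, τ) * ∑ j, u (x, τ) j * sderiv j η (x, τ))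
        (volume.restrict (ball3 xb 1)) ∧
      ∀ c : ℝ, ∫ x in ball3 xb 1, p (x, τ) * ∑ j, u (x, τ) j * sderiv j η (x, τ) =
        ∫ x in ball3 xb 1, (p (x, τ) - c) * ∑ j, u (x, τ) j * sderiv j η (x, τ) := by
  obtain ⟨M, -, hMb⟩ := exists_abs_sderiv_le hη hηc
  have hmeas := measurable_sum_mul_sderiv hu hη
  have hint : IntegrableOn (fun z => ∑ j, u z j * sderiv j η z) (Qcyl (xb, tb) 1) := by
    refine Integrable.mono' (hui.norm.mul_const (3 * M)) hmeas.aestronglyMeasurable ?_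
    filter_upwards with z using abs_sum_mul_le _ _ fun j => hMb j z
  have hint2 : IntegrableOn (fun z => p z * ∑ j, u z j * sderiv j η z) (Qcyl (xb, tb) 1) := by
    refine Integrable.mono' (hpu.mul_const (3 * M)) (hp.mul hmeas).aestronglyMeasurable ?_
    filter_upwards with z
    rw [Real.norm_eq_abs, abs_mul, mul_assoc]
    exact mul_le_mul_of_nonneg_left (abs_sum_mul_le _ _ fun j => hMb j z) (abs_nonneg _)
  rw [IntegrableOn, volume_restrict_Qcyl_one] at hint hint2
  filter_upwards [ae_slice_divFree hu hui hdiv hη hηc hηs, hint.prod_left_ae, hint2.prod_left_ae]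
    with τ h0 h1 h2
  refine ⟨h2, fun c => ?_⟩
  simp only [sub_mul]
  rw [integral_sub h2 (h1.const_mul c), integral_const_mul, h0, mul_zero, sub_zero]

theorem measurable_nsq2 : Measurable nsq2 := by unfold nsq2; fun_prop

theorem measurable_nsq3 : Measurable nsq3 := by unfold nsq3; fun_prop

theorem nsq2_nonneg (M : Fin 3 → Fin 3 → ℝ) : 0 ≤ nsq2 M :=
  Finset.sum_nonneg fun _ _ => Finset.sum_nonneg fun _ _ => sq_nonneg _

theorem nsq3_nonneg (A : Fin 3 → Fin 3 → Fin 3 → ℝ) : 0 ≤ nsq3 A :=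
  Finset.sum_nonneg fun _ _ => Finset.sum_nonneg fun _ _ => Finset.sum_nonneg fun _ _ =>
    sq_nonneg _

theorem lintegral_energy_le {xb : E3} {tb Cb ρb : ℝ} (hCb : 0 ≤ Cb) (hρ : 0 ≤ ρb)
    {u d : SpT → E3} {p : SpT → ℝ}
    {Du Dd : SpT → Fin 3 → Fin 3 → ℝ} {D2d : SpT → Fin 3 → Fin 3 → Fin 3 → ℝ}
    (hreg : QReg xb tb u d p Du Dd D2d) (hle : LocalEnergyQ xb tb Cb ρb u d p Du Dd D2d)
    (heu : IntegrableOn (fun z => ‖u z‖ ^ 2 + nsq2 (Dd z)) (Qcyl (xb, tb) 1))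
    {φ : SpT → ℝ} (hφ : ContDiff ℝ (⊤ : ℕ∞) φ) (hφc : HasCompactSupport φ)
    (hφs : tsupport φ ⊆ ball3 xb 1 ×ˢ Ioi (tb - 1)) (hφ0 : ∀ z, 0 ≤ φ z)
    {t₀ : ℝ} {G₁ G₂ : SpT → ℝ≥0∞} (hG₁ : Measurable G₁) (hG₂ : Measurable G₂)
    (h₁ : ∀ z : SpT, z.2 < t₀ →
      ENNReal.ofReal ((‖u z‖ ^ 2 + nsq2 (Dd z)) * |tderiv φ z + sLap φ z| +
          (‖u z‖ ^ 3 + Real.sqrt (nsq2 (Dd z)) ^ 3) * Real.sqrt (∑ j, (sderiv j φ z) ^ 2) +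
          ρb * ‖d z‖ ^ 2 * nsq2 (Dd z) * φ z) ≤ G₁ z)
    (h₂ : ∀ᵐ τ ∂(volume.restrict (Ioo (tb - 1) tb)), τ < t₀ →
      ‖∫ x in ball3 xb 1, p (x, τ) * ∑ j, u (x, τ) j * sderiv j φ (x, τ)‖ₑ ≤
        ∫⁻ x in ball3 xb 1, G₂ (x, τ)) :
    ∀ᵐ t ∂(volume.restrict (Ioo (tb - 1) tb)), t < t₀ →
      (∫⁻ x in ball3 xb 1, ENNReal.ofReal ((‖u (x, t)‖ ^ 2 + nsq2 (Dd (x, t))) * φ (x, t))) +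
        (∫⁻ z in ball3 xb 1 ×ˢ Ioo (tb - 1) t,
          ENNReal.ofReal ((nsq2 (Du z) + nsq3 (D2d z)) * φ z)) ≤
      ENNReal.ofReal Cb *
        ((∫⁻ z in Qcyl (xb, tb) 1, G₁ z) + ∫⁻ z in Qcyl (xb, tb) 1, G₂ z) := by
  obtain ⟨M, hM⟩ := hφc.exists_bound_of_continuous hφ.continuous
  have hi1 : IntegrableOn (fun z => (‖u z‖ ^ 2 + nsq2 (Dd z)) * φ z) (Qcyl (xb, tb) 1) :=
    heu.mul_bdd (c := M) hφ.continuous.aestronglyMeasurable (Eventually.of_forall hM)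
  have hi2 : IntegrableOn (fun z => (nsq2 (Du z) + nsq3 (D2d z)) * φ z) (Qcyl (xb, tb) 1) :=
    (hreg.l2_Du.add hreg.l2_D2d).mul_bdd (c := M) hφ.continuous.aestronglyMeasurable
      (Eventually.of_forall hM)
  have hi1' := hi1
  rw [IntegrableOn, volume_restrict_Qcyl_one] at hi1'
  have heu0 : ∀ z, 0 ≤ ‖u z‖ ^ 2 + nsq2 (Dd z) := fun z =>
    add_nonneg (sq_nonneg _) (nsq2_nonneg _)
  filter_upwards [hle, hi1'.prod_left_ae, ae_restrict_mem measurableSet_Ioo]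
    with t ht hit htm htt
  have hsub : Ioo (tb - 1) t ⊆ Ioo (tb - 1) tb := Ioo_subset_Ioo_right htm.2.le
  have key := ht φ hφ hφc hφs hφ0
  have hprod : (volume : Measure SpT).restrict (ball3 xb 1 ×ˢ Ioo (tb - 1) t) =
      ((volume : Measure E3).restrict (ball3 xb 1)).prod (volume.restrict (Ioo (tb - 1) t)) := by
    rw [Measure.prod_restrict, ← Measure.volume_eq_prod]
  have hsubQ : ball3 xb 1 ×ˢ Ioo (tb - 1) t ⊆ Qcyl (xb, tb) 1 := by
    simpa [Qcyl] using prod_mono_right hsub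
  have hi2t := hi2.mono_set hsubQ
  have e2 : ∫ τ in Ioo (tb - 1) t, ∫ x in ball3 xb 1,
        (nsq2 (Du (x, τ)) + nsq3 (D2d (x, τ))) * φ (x, τ) =
      ∫ z in ball3 xb 1 ×ˢ Ioo (tb - 1) t, (nsq2 (Du z) + nsq3 (D2d z)) * φ z := by
    rw [IntegrableOn, hprod] at hi2t
    rw [hprod, integral_prod_symm _ hi2t]
  rw [e2] at key
  have hn1 : ∀ z, 0 ≤ (‖u z‖ ^ 2 + nsq2 (Dd z)) * φ z := fun z => mul_nonneg (heu0 z) (hφ0 z)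
  have hn2 : ∀ z, 0 ≤ (nsq2 (Du z) + nsq3 (D2d z)) * φ z := fun z =>
    mul_nonneg (add_nonneg (nsq2_nonneg _) (nsq3_nonneg _)) (hφ0 z)
  have key2 := ENNReal.ofReal_le_ofReal key
  rw [ENNReal.ofReal_add (integral_nonneg fun x => hn1 _) (integral_nonneg fun x => hn2 _),
    ofReal_integral_eq_lintegral_ofReal hit (Eventually.of_forall fun x => hn1 _),
    ofReal_integral_eq_lintegral_ofReal hi2t (Eventually.of_forall fun x => hn2 _),
    ENNReal.ofReal_mul hCb] at key2
  refine key2.trans (mul_le_mul_right ?_ _)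
  refine (Real.ofReal_le_enorm _).trans ((enorm_integral_le_lintegral_enorm _).trans ?_)
  calc _ ≤ ∫⁻ τ in Ioo (tb - 1) t,
        ((∫⁻ x in ball3 xb 1, G₁ (x, τ)) + ∫⁻ x in ball3 xb 1, G₂ (x, τ)) := by
        refine lintegral_mono_ae ?_
        filter_upwards [ae_restrict_of_ae_restrict_of_subset hsub h₂,
          ae_restrict_mem measurableSet_Ioo] with τ hτ hτm
        have hτ0 : τ < t₀ := hτm.2.trans htt
        refine (enorm_add_le _ _).trans (add_le_add ?_ ?_)
        · refine (enorm_integral_le_lintegral_enorm _).trans (lintegral_mono fun x => ?_)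
          rw [Real.enorm_of_nonneg]
          · exact h₁ (x, τ) hτ0
          · have := heu0 (x, τ)
            have := nsq2_nonneg (Dd (x, τ))
            have := hφ0 (x, τ)
            positivity
        · rw [Real.enorm_abs]
          exact hτ hτ0
    _ ≤ ∫⁻ τ in Ioo (tb - 1) tb,
        ((∫⁻ x in ball3 xb 1, G₁ (x, τ)) + ∫⁻ x in ball3 xb 1, G₂ (x, τ)) :=
        lintegral_mono_set hsub
    _ = _ := by
        rw [volume_restrict_Qcyl_one, lintegral_prod_symm' _ hG₁, lintegral_prod_symm' _ hG₂,
          lintegral_add_left]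
        exact hG₁.lintegral_prod_left'

theorem mem_Qcyl_iff_sub {z z₀ : SpT} {r : ℝ} : z ∈ Qcyl z₀ r ↔ z - z₀ ∈ Qcyl 0 r := by
  rw [mem_Qcyl_zero]
  simp only [Qcyl, ball3, mem_prod, Metric.mem_ball, mem_Ioo, dist_eq_norm, Prod.fst_sub,
    Prod.snd_sub]
  constructor <;> rintro ⟨h1, h2, h3⟩ <;> exact ⟨h1, by linarith, by linarith⟩

theorem tsupport_translate_subset {ψ : SpT → ℝ} {z₀ : SpT} {r s : ℝ}
    (h : tsupport ψ ⊆ ball3 0 r ×ˢ Ioi s) :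
    tsupport (fun z => ψ (z - z₀)) ⊆ ball3 z₀.1 r ×ˢ Ioi (z₀.2 + s) := by
  intro z hz
  have h1 := h (tsupport_comp_subset_preimage ψ (f := fun z : SpT => z - z₀) (by fun_prop) hz)
  simp only [ball3, mem_prod, Metric.mem_ball, mem_Ioi, dist_eq_norm, Prod.fst_sub,
    Prod.snd_sub, sub_zero] at h1 ⊢
  exact ⟨h1.1, by linarith [h1.2]⟩

/-- A truncated backward heat kernel at scale `2⁻ⁿ` centred at `z₀`, with a dyadic decomposition. -/
structure IsHeatTest (C c : ℝ) (z₀ : SpT) (n : ℕ) (φ : SpT → ℝ) (η : ℕ → SpT → ℝ) : Prop where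
  smooth : ContDiff ℝ (⊤ : ℕ∞) φ
  compact : HasCompactSupport φ
  supp : tsupport φ ⊆ ball3 z₀.1 (1 / 2) ×ˢ Ioi (z₀.2 - 1 / 4)
  nonneg : ∀ z, 0 ≤ φ z
  lower : ∀ z ∈ Qcyl z₀ (rdy n), c * 8 ^ n ≤ φ z
  heat : ∀ z : SpT, z.2 < z₀.2 → |tderiv φ z + sLap φ z| ≤ C
  upper : ∀ z : SpT, z.2 < z₀.2 → φ z ≠ 0 →
    ∃ k ∈ Finset.Icc 1 n, z ∈ Qcyl z₀ (rdy k) ∧ φ z ≤ C * 8 ^ k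
  decomp : ∀ z, φ z = ∑ k ∈ Finset.Icc 1 n, η k z
  smooth_piece : ∀ k ∈ Finset.Icc 1 n, ContDiff ℝ (⊤ : ℕ∞) (η k)
  compact_piece : ∀ k ∈ Finset.Icc 1 n, HasCompactSupport (η k)
  supp_piece : ∀ k ∈ Finset.Icc 1 n, tsupport (η k) ⊆ ball3 z₀.1 (1 / 2) ×ˢ Ioi (z₀.2 - 1 / 4)
  deriv_piece : ∀ k ∈ Finset.Icc 1 n, ∀ z : SpT, z.2 < z₀.2 → z ∉ Qcyl z₀ (rdy k) →
    ∀ j, sderiv j (η k) z = 0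
  deriv_piece_le : ∀ k ∈ Finset.Icc 1 n, ∀ z : SpT, z.2 < z₀.2 →
    ∀ j, |sderiv j (η k) z| ≤ C * 16 ^ k

theorem exists_isHeatTest : ∃ C : ℝ, 0 < C ∧ ∃ c : ℝ, 0 < c ∧ ∀ (z₀ : SpT) (n : ℕ), 2 ≤ n →
    ∃ φ η, IsHeatTest C c z₀ n φ η := by
  obtain ⟨C, hC, c, hc, H⟩ := exists_test_functions
  refine ⟨C, hC, c, hc, fun z₀ n hn => ?_⟩
  obtain ⟨φ, η, ⟨h1, h2, h3⟩, h4, h5, h6, h7, h8, h9, h10, h11⟩ := H n hn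
  have hs : ∀ {z : SpT}, z.2 < z₀.2 → (z - z₀).2 < 0 := fun h => by simpa using h
  have hcs : ∀ {ψ : SpT → ℝ}, HasCompactSupport ψ →
      HasCompactSupport fun z => ψ (z - z₀) := fun {ψ} h => by
    simpa [Function.comp_def, sub_eq_add_neg] using
      h.comp_homeomorph (Homeomorph.addRight (-z₀))
  refine ⟨fun z => φ (z - z₀), fun k z => η k (z - z₀), ?_⟩
  constructor
  · exact h1.comp (contDiff_id.sub contDiff_const)
  · exact hcs h2
  · exact tsupport_translate_subset h3
  · exact fun z => h4 _
  · exact fun z hz => h5 _ (mem_Qcyl_iff_sub.1 hz)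
  · intro z hz
    rw [tderiv_translate, sLap_translate]
    exact h6 _ (hs hz)
  · intro z hz h0
    obtain ⟨k, hk, hkm, hkb⟩ := h7 _ (hs hz) h0
    exact ⟨k, hk, mem_Qcyl_iff_sub.2 hkm, hkb⟩
  · exact fun z => h8 _
  · exact fun k hk => (h9 k hk).1.comp (contDiff_id.sub contDiff_const)
  · exact fun k hk => hcs (h9 k hk).2.1
  · exact fun k hk => tsupport_translate_subset (h9 k hk).2.2
  · intro k hk z hz hzm j
    rw [sderiv_translate]
    exact h10 k hk _ (hs hz) (fun h => hzm (mem_Qcyl_iff_sub.2 h)) j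
  · intro k hk z hz j
    rw [sderiv_translate]
    exact h11 k hk _ (hs hz) j

theorem IsHeatTest.sderiv_eq {C c : ℝ} {z₀ : SpT} {n : ℕ} {φ : SpT → ℝ} {η : ℕ → SpT → ℝ}
    (h : IsHeatTest C c z₀ n φ η) (j : Fin 3) (z : SpT) :
    sderiv j φ z = ∑ k ∈ Finset.Icc 1 n, sderiv j (η k) z := by
  have e : φ = fun z => ∑ k ∈ Finset.Icc 1 n, η k z := funext h.decomp
  unfold sderiv
  rw [e, fderiv_fun_sum fun k hk => (h.smooth_piece k hk).differentiable (by simp) z]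
  simp

theorem IsHeatTest.abs_sderiv_piece_le {C c : ℝ} {z₀ : SpT} {n : ℕ} {φ : SpT → ℝ}
    {η : ℕ → SpT → ℝ} (h : IsHeatTest C c z₀ n φ η) {k : ℕ} (hk : k ∈ Finset.Icc 1 n) (j : Fin 3)
    {z : SpT} (hz : z.2 < z₀.2) :
    |sderiv j (η k) z| ≤ (Qcyl z₀ (rdy k)).indicator (fun _ => C * 16 ^ k) z := by
  by_cases hm : z ∈ Qcyl z₀ (rdy k)
  · rw [indicator_of_mem hm]
    exact h.deriv_piece_le k hk z hz j
  · rw [indicator_of_notMem hm, h.deriv_piece k hk z hz hm j, abs_zero]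

theorem sqrt_sum_sq_le_sum_abs (a : Fin 3 → ℝ) : Real.sqrt (∑ j, a j ^ 2) ≤ ∑ j, |a j| := by
  refine Real.sqrt_le_iff.2 ⟨Finset.sum_nonneg fun _ _ => abs_nonneg _, ?_⟩
  simpa using Finset.sum_sq_le_sq_sum_of_nonneg (s := Finset.univ) (f := fun j => |a j|)
    fun _ _ => abs_nonneg _

theorem IsHeatTest.sqrt_sderiv_le {C c : ℝ} {z₀ : SpT} {n : ℕ} {φ : SpT → ℝ}
    {η : ℕ → SpT → ℝ} (h : IsHeatTest C c z₀ n φ η) {z : SpT} (hz : z.2 < z₀.2) :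
    Real.sqrt (∑ j, (sderiv j φ z) ^ 2) ≤
      ∑ k ∈ Finset.Icc 1 n, (Qcyl z₀ (rdy k)).indicator (fun _ => 3 * C * 16 ^ k) z := by
  refine (sqrt_sum_sq_le_sum_abs _).trans ?_
  calc ∑ j, |sderiv j φ z| ≤ ∑ _j : Fin 3, ∑ k ∈ Finset.Icc 1 n,
        (Qcyl z₀ (rdy k)).indicator (fun _ => C * 16 ^ k) z := by
        refine Finset.sum_le_sum fun j _ => ?_
        rw [h.sderiv_eq]
        exact (Finset.abs_sum_le_sum_abs _ _).trans
          (Finset.sum_le_sum fun k hk => h.abs_sderiv_piece_le hk j hz)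
    _ = _ := by
        rw [Finset.sum_const, Finset.card_univ, Fintype.card_fin, Finset.smul_sum]
        refine Finset.sum_congr rfl fun k _ => ?_
        by_cases hm : z ∈ Qcyl z₀ (rdy k) <;> simp [hm]; ring

/-- Young's inequality for the coupling term of the energy inequality. -/
theorem coupling_le {q a s φ : ℝ} (hq : q ∈ Ioc (5 : ℝ) 6) (ha : 0 ≤ a) (hs : 0 ≤ s)
    (hφ : 0 ≤ φ) :
    a ^ 2 * s ^ 2 * φ ≤ a ^ q * s ^ (3 * (1 - q / 6)) + s ^ 3 * φ ^ (q / (q - 2)) := by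
  obtain ⟨h5, h6⟩ := hq
  have hq0 : 0 < q := by linarith
  have hq2 : 0 < q - 2 := by linarith
  rcases hs.eq_or_lt with rfl | hs
  · have := Real.rpow_nonneg ha q
    have := Real.rpow_nonneg le_rfl (3 * (1 - q / 6))
    simp; positivity
  have hpq : (q / 2).HolderConjugate (q / (q - 2)) := by
    rw [Real.holderConjugate_iff]
    refine ⟨by linarith, ?_⟩
    field_simp
    ring
  have hy := Real.young_inequality_of_nonneg (a := a ^ 2 * s ^ ((6 - q) / q))
    (b := φ * s ^ (3 * (1 - 2 / q))) (by positivity) (by positivity) hpq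
  have e0 : a ^ 2 * s ^ ((6 - q) / q) * (φ * s ^ (3 * (1 - 2 / q))) = a ^ 2 * s ^ 2 * φ := by
    have : s ^ ((6 - q) / q) * s ^ (3 * (1 - 2 / q)) = s ^ 2 := by
      rw [← Real.rpow_add hs, ← Real.rpow_natCast]
      congr 1
      field_simp
      ring
    rw [← this]; ring
  have e1 : (a ^ 2 * s ^ ((6 - q) / q)) ^ (q / 2) = a ^ q * s ^ (3 * (1 - q / 6)) := by
    rw [Real.mul_rpow (by positivity) (by positivity), ← Real.rpow_natCast, ← Real.rpow_mul ha,
      ← Real.rpow_mul hs.le]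
    congr 2
    · push_cast; field_simp
    · field_simp; ring
  have e2 : (φ * s ^ (3 * (1 - 2 / q))) ^ (q / (q - 2)) = s ^ 3 * φ ^ (q / (q - 2)) := by
    rw [Real.mul_rpow (by positivity) (by positivity), ← Real.rpow_mul hs.le, mul_comm,
      ← Real.rpow_natCast]
    congr 2
    push_cast; field_simp
  rw [e0, e1, e2] at hy
  refine hy.trans (add_le_add (div_le_self (by positivity) (by linarith))
    (div_le_self (by positivity) hpq.symm.lt.le))

theorem rpow_conj_le {q C φ : ℝ} (hq : q ∈ Ioc (5 : ℝ) 6) (hφ : 0 ≤ φ) {k : ℕ}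
    (h : φ ≤ C * 8 ^ k) :
    φ ^ (q / (q - 2)) ≤ (1 + C) ^ 2 * 2 ^ (3 * q / (q - 2) * k) := by
  obtain ⟨h5, h6⟩ := hq
  have hq2 : 0 < q - 2 := by linarith
  have hC : 0 ≤ C := by
    by_contra hC
    have : C * 8 ^ k < 0 := mul_neg_of_neg_of_pos (not_le.1 hC) (by positivity)
    linarith
  have he : q / (q - 2) ≤ 2 := by rw [div_le_iff₀ hq2]; linarith
  have he0 : 0 ≤ q / (q - 2) := by positivity
  calc φ ^ (q / (q - 2)) ≤ ((1 + C) * 8 ^ k) ^ (q / (q - 2)) :=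
        Real.rpow_le_rpow hφ (h.trans (by gcongr; linarith)) he0
    _ = (1 + C) ^ (q / (q - 2)) * 2 ^ (3 * q / (q - 2) * k) := by
        rw [Real.mul_rpow (by positivity) (by positivity)]
        congr 1
        rw [← Real.rpow_natCast, show (8 : ℝ) = 2 ^ (3 : ℝ) by norm_num, ← Real.rpow_mul (by norm_num),
          ← Real.rpow_mul (by norm_num)]
        congr 1
        ring
    _ ≤ _ := by
        gcongr
        refine (Real.rpow_le_rpow_of_exponent_le (by linarith) he).trans_eq ?_
        norm_cast

theorem sixteen_mul_rpow_le {q : ℝ} (hq : q ∈ Ioc (5 : ℝ) 6) (k : ℕ) :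
    (16 : ℝ) ^ k * 2 ^ ((k : ℝ) / 3) ≤ 2 ^ (3 * q / (q - 2) * k) := by
  obtain ⟨h5, h6⟩ := hq
  have hq2 : 0 < q - 2 := by linarith
  rw [← Real.rpow_natCast, show (16 : ℝ) = 2 ^ (4 : ℝ) by norm_num, ← Real.rpow_mul (by norm_num),
    ← Real.rpow_add (by norm_num)]
  refine Real.rpow_le_rpow_of_exponent_le (by norm_num) ?_
  have : (13 / 3 : ℝ) ≤ 3 * q / (q - 2) := by rw [le_div_iff₀ hq2]; linarith
  have hk : (0 : ℝ) ≤ k := by positivity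
  nlinarith

theorem rpow_le_thirtytwo {q : ℝ} (hq : q ∈ Ioc (5 : ℝ) 6) (k : ℕ) :
    (2 : ℝ) ^ (3 * q / (q - 2) * k) ≤ 32 ^ k := by
  obtain ⟨h5, h6⟩ := hq
  have hq2 : 0 < q - 2 := by linarith
  rw [← Real.rpow_natCast, show (32 : ℝ) = 2 ^ (5 : ℝ) by norm_num, ← Real.rpow_mul (by norm_num)]
  refine Real.rpow_le_rpow_of_exponent_le (by norm_num) ?_
  have : 3 * q / (q - 2) ≤ 5 := by rw [div_le_iff₀ hq2]; linarith
  gcongr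

theorem energy_integrand_le {q C c ρb a w s : ℝ} (hq : q ∈ Ioc (5 : ℝ) 6) (hC : 0 < C)
    (hρ : ρb ∈ Ioc (0 : ℝ) 1) (ha : 0 ≤ a) (hw : 0 ≤ w) (hs : 0 ≤ s)
    {z₀ : SpT} {n : ℕ} {φ : SpT → ℝ} {η : ℕ → SpT → ℝ} (h : IsHeatTest C c z₀ n φ η)
    {z : SpT} (hz : z.2 < z₀.2) :
    (w ^ 2 + s) * |tderiv φ z + sLap φ z| +
        (w ^ 3 + Real.sqrt s ^ 3) * Real.sqrt (∑ j, (sderiv j φ z) ^ 2) +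
        ρb * a ^ 2 * s * φ z ≤
      C * (w ^ 2 + s) + a ^ q * Real.sqrt s ^ (3 * (1 - q / 6)) +
        ∑ k ∈ Finset.Icc 1 n, (Qcyl z₀ (rdy k)).indicator (fun _ =>
          (3 * C + (1 + C) ^ 2) * 2 ^ (3 * q / (q - 2) * k) * (w ^ 3 + Real.sqrt s ^ 3)) z := by
  have hS := Real.sqrt_nonneg s
  have hF : 0 ≤ w ^ 3 + Real.sqrt s ^ 3 := by positivity
  have t1 : (w ^ 2 + s) * |tderiv φ z + sLap φ z| ≤ C * (w ^ 2 + s) := by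
    rw [mul_comm]
    gcongr
    exact h.heat z hz
  have t2 : (w ^ 3 + Real.sqrt s ^ 3) * Real.sqrt (∑ j, (sderiv j φ z) ^ 2) ≤
      ∑ k ∈ Finset.Icc 1 n, (Qcyl z₀ (rdy k)).indicator (fun _ =>
          3 * C * 2 ^ (3 * q / (q - 2) * k) * (w ^ 3 + Real.sqrt s ^ 3)) z := by
    refine (mul_le_mul_of_nonneg_left (h.sqrt_sderiv_le hz) hF).trans ?_
    rw [Finset.mul_sum]
    refine Finset.sum_le_sum fun k _ => ?_
    by_cases hm : z ∈ Qcyl z₀ (rdy k)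
    · have h1 : (16 : ℝ) ^ k ≤ 2 ^ (3 * q / (q - 2) * k) := by
        refine le_trans ?_ (sixteen_mul_rpow_le hq k)
        exact le_mul_of_one_le_right (by positivity)
          (Real.one_le_rpow (by norm_num) (by positivity))
      simp only [hm, indicator_of_mem]
      rw [mul_comm]
      gcongr
    · simp [hm]
  have t3 : ρb * a ^ 2 * s * φ z ≤ a ^ q * Real.sqrt s ^ (3 * (1 - q / 6)) +
      ∑ k ∈ Finset.Icc 1 n, (Qcyl z₀ (rdy k)).indicator (fun _ =>
          (1 + C) ^ 2 * 2 ^ (3 * q / (q - 2) * k) * (w ^ 3 + Real.sqrt s ^ 3)) z := by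
    have hA : 0 ≤ a ^ q * Real.sqrt s ^ (3 * (1 - q / 6)) :=
      mul_nonneg (Real.rpow_nonneg ha _) (Real.rpow_nonneg hS _)
    have hsum : ∀ k ∈ Finset.Icc 1 n, 0 ≤ (Qcyl z₀ (rdy k)).indicator (fun _ =>
          (1 + C) ^ 2 * 2 ^ (3 * q / (q - 2) * k) * (w ^ 3 + Real.sqrt s ^ 3)) z :=
      fun k _ => indicator_nonneg (fun _ _ => by positivity) _
    rcases eq_or_ne (φ z) 0 with h0 | h0
    · rw [h0, mul_zero]
      exact add_nonneg hA (Finset.sum_nonneg hsum)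
    obtain ⟨k, hk, hkm, hkb⟩ := h.upper z hz h0
    have hφ := h.nonneg z
    have hy := coupling_le hq ha hS hφ
    rw [Real.sq_sqrt hs] at hy
    calc ρb * a ^ 2 * s * φ z ≤ 1 * a ^ 2 * s * φ z := by
          gcongr
          exact hρ.2
      _ = a ^ 2 * s * φ z := by ring
      _ ≤ _ := hy
      _ ≤ _ := by
        refine add_le_add le_rfl (le_trans ?_ (Finset.single_le_sum hsum hk))
        rw [indicator_of_mem hkm, mul_comm]
        gcongr
        · exact rpow_conj_le hq hφ hkb
        · linarith [pow_nonneg hw 3]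
  have e : ∑ k ∈ Finset.Icc 1 n, (Qcyl z₀ (rdy k)).indicator (fun _ =>
          (3 * C + (1 + C) ^ 2) * 2 ^ (3 * q / (q - 2) * k) * (w ^ 3 + Real.sqrt s ^ 3)) z =
      ∑ k ∈ Finset.Icc 1 n, (Qcyl z₀ (rdy k)).indicator (fun _ =>
          3 * C * 2 ^ (3 * q / (q - 2) * k) * (w ^ 3 + Real.sqrt s ^ 3)) z +
      ∑ k ∈ Finset.Icc 1 n, (Qcyl z₀ (rdy k)).indicator (fun _ =>
          (1 + C) ^ 2 * 2 ^ (3 * q / (q - 2) * k) * (w ^ 3 + Real.sqrt s ^ 3)) z := by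
    rw [← Finset.sum_add_distrib]
    refine Finset.sum_congr rfl fun k _ => ?_
    by_cases hm : z ∈ Qcyl z₀ (rdy k)
    · simp only [hm, indicator_of_mem]; ring
    · simp [hm]
  rw [e]
  linarith

theorem ae_pressure_le {xb : E3} {tb : ℝ} {u : SpT → E3} {p : SpT → ℝ}
    (hu : Measurable u) (hp : Measurable p)
    (hui : IntegrableOn u (Qcyl (xb, tb) 1))
    (hpu : IntegrableOn (fun z => |p z| * ‖u z‖) (Qcyl (xb, tb) 1))
    (hdiv : DivFreeOn (Qcyl (xb, tb) 1) u)
    {C c : ℝ} {z₀ : SpT} {n : ℕ} {φ : SpT → ℝ} {η : ℕ → SpT → ℝ}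
    (h : IsHeatTest C c z₀ n φ η) (hB : ball3 z₀.1 (1 / 2) ⊆ ball3 xb 1) (m : ℕ → ℝ → ℝ)
    (hm : ∀ k, Measurable (m k)) :
    ∀ᵐ τ ∂(volume.restrict (Ioo (tb - 1) tb)), τ < z₀.2 →
      ‖∫ x in ball3 xb 1, p (x, τ) * ∑ j, u (x, τ) j * sderiv j φ (x, τ)‖ₑ ≤
        ∫⁻ x in ball3 xb 1, ∑ k ∈ Finset.Icc 1 n, (Qcyl z₀ (rdy k)).indicator (fun z =>
          ENNReal.ofReal (3 * C * 16 ^ k) * ENNReal.ofReal (‖u z‖ * |p z - m k z.2|)) (x, τ) := by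
  have hae : ∀ᵐ τ ∂(volume.restrict (Ioo (tb - 1) tb)), ∀ k ∈ Finset.Icc 1 n,
      Integrable (fun x => p (x, τ) * ∑ j, u (x, τ) j * sderiv j (η k) (x, τ))
        (volume.restrict (ball3 xb 1)) ∧
      ∀ a : ℝ, ∫ x in ball3 xb 1, p (x, τ) * ∑ j, u (x, τ) j * sderiv j (η k) (x, τ) =
        ∫ x in ball3 xb 1, (p (x, τ) - a) * ∑ j, u (x, τ) j * sderiv j (η k) (x, τ) := by
    rw [Finset.eventually_all]
    intro k hk
    refine ae_slice_pressure_eq hu hp hui hpu hdiv (h.smooth_piece k hk) (h.compact_piece k hk) ?_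
    exact (h.supp_piece k hk).trans (prod_mono hB (subset_univ _))
  filter_upwards [hae] with τ hτ hτ0
  have e : ∀ x, p (x, τ) * ∑ j, u (x, τ) j * sderiv j φ (x, τ) =
      ∑ k ∈ Finset.Icc 1 n, p (x, τ) * ∑ j, u (x, τ) j * sderiv j (η k) (x, τ) := by
    intro x
    rw [← Finset.mul_sum, Finset.sum_comm]
    simp only [h.sderiv_eq, Finset.mul_sum]
  simp only [e]
  rw [integral_finsetSum _ fun k hk => (hτ k hk).1, lintegral_finsetSum']
  · refine (enorm_sum_le _ _).trans (Finset.sum_le_sum fun k hk => ?_)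
    rw [(hτ k hk).2 (m k τ)]
    refine (enorm_integral_le_lintegral_enorm _).trans (lintegral_mono fun x => ?_)
    by_cases hx : (x, τ) ∈ Qcyl z₀ (rdy k)
    · have hC : 0 ≤ C * 16 ^ k := (abs_nonneg _).trans (h.deriv_piece_le k hk (x, τ) hτ0 0)
      rw [indicator_of_mem hx, ← ENNReal.ofReal_mul (by linarith), Real.enorm_eq_ofReal_abs, abs_mul]
      refine ENNReal.ofReal_le_ofReal ?_
      calc _ ≤ |p (x, τ) - m k τ| * (‖u (x, τ)‖ * (3 * (C * 16 ^ k))) := by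
            gcongr
            exact abs_sum_mul_le _ _ fun j => h.deriv_piece_le k hk (x, τ) hτ0 j
        _ = _ := by ring
    · have : ∀ j, sderiv j (η k) (x, τ) = 0 := h.deriv_piece k hk (x, τ) hτ0 hx
      simp [this]
  · intro k _
    refine Measurable.aemeasurable ?_
    have : Measurable ((Qcyl z₀ (rdy k)).indicator (fun z =>
          ENNReal.ofReal (3 * C * 16 ^ k) * ENNReal.ofReal (‖u z‖ * |p z - m k z.2|))) := by
      refine Measurable.indicator ?_ (isOpen_Qcyl _ _).measurableSet
      have := hm k
      fun_prop
    exact this.comp measurable_prodMk_right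

theorem ball3_half_subset {xb : E3} {tb : ℝ} {z₀ : SpT} (hz₀ : z₀ ∈ Qcyl (xb, tb) (1 / 2)) :
    ball3 z₀.1 (1 / 2) ⊆ ball3 xb 1 := by
  have := hz₀.1
  refine Metric.ball_subset_ball' ?_
  simp only [ball3, Metric.mem_ball] at this
  linarith

theorem rdy_le_half {k : ℕ} (hk : 1 ≤ k) : rdy k ≤ 1 / 2 := by
  simpa [rdy] using rdy_antitone hk

theorem Qcyl_rdy_subset {xb : E3} {tb : ℝ} {z₀ : SpT} (hz₀ : z₀ ∈ Qcyl (xb, tb) (1 / 2)) {k : ℕ}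
    (hk : 1 ≤ k) : Qcyl z₀ (rdy k) ⊆ Qcyl (xb, tb) 1 := by
  have h1 := rdy_le_half hk
  have h0 := rdy_pos k
  have h2 := hz₀.2
  simp only [mem_Ioo] at h2
  refine prod_mono ((Metric.ball_subset_ball h1).trans (ball3_half_subset hz₀))
    (Ioo_subset_Ioo ?_ h2.2.le)
  simp only
  nlinarith

/-- The right-hand side of the dyadic energy estimate. -/
def dyadicBound (xb : E3) (tb : ℝ) (u d : SpT → E3) (p : SpT → ℝ) (Dd : SpT → Fin 3 → Fin 3 → ℝ)
    (z₀ : SpT) (q : ℝ) (n : ℕ) (C : ℝ) (m : ℕ → ℝ → ℝ) : ℝ≥0∞ :=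
  ENNReal.ofReal C * (∫⁻ z in Qcyl (xb, tb) 1, ENNReal.ofReal (‖u z‖ ^ 2 + nsq2 (Dd z))) +
    (∫⁻ z in Qcyl (xb, tb) 1,
      ENNReal.ofReal (‖d z‖ ^ q * Real.sqrt (nsq2 (Dd z)) ^ (3 * (1 - q / 6)))) +
    ∑ k ∈ Finset.Icc 1 n,
      (ENNReal.ofReal ((3 * C + (1 + C) ^ 2) * 2 ^ (3 * q / (q - 2) * k)) *
          (∫⁻ z in Qcyl z₀ (rdy k), ENNReal.ofReal (‖u z‖ ^ 3 + Real.sqrt (nsq2 (Dd z)) ^ 3)) +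
        ENNReal.ofReal (3 * C * 16 ^ k) *
          ∫⁻ z in Qcyl z₀ (rdy k), ENNReal.ofReal (‖u z‖ * |p z - m k z.2|))

theorem ae_energy_le_dyadicBound {xb : E3} {tb Cb ρb : ℝ} (hCb : 0 ≤ Cb)
    (hρ : ρb ∈ Ioc (0 : ℝ) 1) {u d : SpT → E3} {p : SpT → ℝ}
    {Du Dd : SpT → Fin 3 → Fin 3 → ℝ} {D2d : SpT → Fin 3 → Fin 3 → Fin 3 → ℝ}
    (hreg : QReg xb tb u d p Du Dd D2d) (hdiv : DivFreeOn (Qcyl (xb, tb) 1) u)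
    (hle : LocalEnergyQ xb tb Cb ρb u d p Du Dd D2d)
    (hui : IntegrableOn u (Qcyl (xb, tb) 1))
    (hpu : IntegrableOn (fun z => |p z| * ‖u z‖) (Qcyl (xb, tb) 1))
    (heu : IntegrableOn (fun z => ‖u z‖ ^ 2 + nsq2 (Dd z)) (Qcyl (xb, tb) 1))
    {z₀ : SpT} (hz₀ : z₀ ∈ Qcyl (xb, tb) (1 / 2)) {q : ℝ} (hq : q ∈ Ioc (5 : ℝ) 6)
    {C c : ℝ} (hC : 0 < C) {n : ℕ} (hn : 1 ≤ n) {φ : SpT → ℝ} {η : ℕ → SpT → ℝ}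
    (h : IsHeatTest C c z₀ n φ η) (m : ℕ → ℝ → ℝ) (hm : ∀ k, Measurable (m k)) :
    ∀ᵐ t ∂(volume.restrict (Ioo (z₀.2 - rdy n ^ 2) z₀.2)),
      ENNReal.ofReal (c * 8 ^ n) *
        ((∫⁻ x in ball3 z₀.1 (rdy n), ENNReal.ofReal (‖u (x, t)‖ ^ 2 + nsq2 (Dd (x, t)))) +
          ∫⁻ z in ball3 z₀.1 (rdy n) ×ˢ Ioo (z₀.2 - rdy n ^ 2) t,
            ENNReal.ofReal (nsq2 (Du z) + nsq3 (D2d z))) ≤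
      ENNReal.ofReal Cb * dyadicBound xb tb u d p Dd z₀ q n C m := by
  have hmu := hreg.meas_u
  have hmd := hreg.meas_d
  have hmp := hreg.meas_p
  have hmn2 : Measurable fun z => nsq2 (Dd z) := measurable_nsq2.comp hreg.meas_Dd
  have hmDu : Measurable fun z => nsq2 (Du z) := measurable_nsq2.comp hreg.meas_Du
  have hmD2 : Measurable fun z => nsq3 (D2d z) := measurable_nsq3.comp hreg.meas_D2d
  have hB := ball3_half_subset hz₀
  have hQn := Qcyl_rdy_subset hz₀ hn
  have hz2 := hz₀.2
  simp only [mem_Ioo] at hz2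
  have hr2 : rdy n ^ 2 ≤ 1 / 4 := by
    have h1 := rdy_le_half hn
    have h0 := rdy_pos n
    nlinarith
  set K : ℕ → ℝ := fun k => (3 * C + (1 + C) ^ 2) * 2 ^ (3 * q / (q - 2) * k) with hK
  have hK0 : ∀ k, 0 ≤ K k := fun k => by positivity
  have hF0 : ∀ z, 0 ≤ ‖u z‖ ^ 3 + Real.sqrt (nsq2 (Dd z)) ^ 3 := fun z => by positivity
  have hmQ : ∀ k, MeasurableSet (Qcyl z₀ (rdy k)) := fun k => (isOpen_Qcyl _ _).measurableSet
  let G₁ : SpT → ℝ≥0∞ := fun z =>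
    ENNReal.ofReal C * ENNReal.ofReal (‖u z‖ ^ 2 + nsq2 (Dd z)) +
      ENNReal.ofReal (‖d z‖ ^ q * Real.sqrt (nsq2 (Dd z)) ^ (3 * (1 - q / 6))) +
      ∑ k ∈ Finset.Icc 1 n, (Qcyl z₀ (rdy k)).indicator (fun z => ENNReal.ofReal (K k) *
        ENNReal.ofReal (‖u z‖ ^ 3 + Real.sqrt (nsq2 (Dd z)) ^ 3)) z
  let G₂ : SpT → ℝ≥0∞ := fun z => ∑ k ∈ Finset.Icc 1 n, (Qcyl z₀ (rdy k)).indicator (fun z =>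
          ENNReal.ofReal (3 * C * 16 ^ k) * ENNReal.ofReal (‖u z‖ * |p z - m k z.2|)) z
  have hmi1 : ∀ k, Measurable ((Qcyl z₀ (rdy k)).indicator (fun z => ENNReal.ofReal (K k) *
        ENNReal.ofReal (‖u z‖ ^ 3 + Real.sqrt (nsq2 (Dd z)) ^ 3))) := fun k =>
    Measurable.indicator (by fun_prop) (hmQ k)
  have hmi2 : ∀ k, Measurable ((Qcyl z₀ (rdy k)).indicator (fun z =>
          ENNReal.ofReal (3 * C * 16 ^ k) * ENNReal.ofReal (‖u z‖ * |p z - m k z.2|))) :=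
    fun k => by
      have := hm k
      exact Measurable.indicator (by fun_prop) (hmQ k)
  have hmA : Measurable fun z => ENNReal.ofReal C * ENNReal.ofReal (‖u z‖ ^ 2 + nsq2 (Dd z)) := by
    fun_prop
  have hmB : Measurable fun z =>
      ENNReal.ofReal (‖d z‖ ^ q * Real.sqrt (nsq2 (Dd z)) ^ (3 * (1 - q / 6))) := by
    fun_prop
  have hmAB : Measurable fun z => ENNReal.ofReal C * ENNReal.ofReal (‖u z‖ ^ 2 + nsq2 (Dd z)) +
      ENNReal.ofReal (‖d z‖ ^ q * Real.sqrt (nsq2 (Dd z)) ^ (3 * (1 - q / 6))) := hmA.add hmB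
  have hG₁ : Measurable G₁ := hmAB.add (Finset.measurable_sum _ fun k _ => hmi1 k)
  have hG₂ : Measurable G₂ := Finset.measurable_sum _ fun k _ => hmi2 k
  have hsum : (∫⁻ z in Qcyl (xb, tb) 1, G₁ z) + (∫⁻ z in Qcyl (xb, tb) 1, G₂ z) =
      dyadicBound xb tb u d p Dd z₀ q n C m := by
    have hint : ∀ (k : ℕ) (g : SpT → ℝ≥0∞), k ∈ Finset.Icc 1 n →
        ∫⁻ z in Qcyl (xb, tb) 1, (Qcyl z₀ (rdy k)).indicator g z =
          ∫⁻ z in Qcyl z₀ (rdy k), g z := by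
      intro k g hk
      rw [setLIntegral_indicator (hmQ k),
        inter_eq_left.2 (Qcyl_rdy_subset hz₀ (Finset.mem_Icc.1 hk).1)]
    simp only [G₁, G₂, dyadicBound]
    rw [lintegral_add_left hmAB, lintegral_add_left hmA,
      lintegral_finsetSum _ fun k _ => hmi1 k, lintegral_finsetSum _ fun k _ => hmi2 k,
      lintegral_const_mul _ (by fun_prop), add_assoc, ← Finset.sum_add_distrib]
    congr 1
    refine Finset.sum_congr rfl fun k hk => ?_
    have := hm k
    rw [hint k _ hk, hint k _ hk, lintegral_const_mul _ (by fun_prop),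
      lintegral_const_mul _ (by fun_prop)]
  have main := lintegral_energy_le hCb hρ.1.le hreg hle heu h.smooth h.compact
    (h.supp.trans (prod_mono hB (Ioi_subset_Ioi (by linarith)))) h.nonneg (t₀ := z₀.2) hG₁ hG₂
    (fun z hz => ?_) (ae_pressure_le hmu hmp hui hpu hdiv h hB m hm)
  · rw [hsum] at main
    have hsub : Ioo (z₀.2 - rdy n ^ 2) z₀.2 ⊆ Ioo (tb - 1) tb :=
      Ioo_subset_Ioo (by linarith) hz2.2.le
    filter_upwards [ae_restrict_of_ae_restrict_of_subset hsub main,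
      ae_restrict_mem measurableSet_Ioo] with t ht htm
    refine le_trans ?_ (ht htm.2)
    have hBn : ball3 z₀.1 (rdy n) ⊆ ball3 xb 1 :=
      (Metric.ball_subset_ball (rdy_le_half hn)).trans hB
    rw [mul_add]
    refine add_le_add ?_ ?_
    · have : Measurable fun x => ENNReal.ofReal (‖u (x, t)‖ ^ 2 + nsq2 (Dd (x, t))) :=
        (by fun_prop : Measurable fun z => ENNReal.ofReal (‖u z‖ ^ 2 + nsq2 (Dd z))).comp
          measurable_prodMk_right
      rw [← lintegral_const_mul _ this]
      refine le_trans ?_ (lintegral_mono_set hBn)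
      refine setLIntegral_mono' Metric.isOpen_ball.measurableSet fun x hx => ?_
      have hz : (x, t) ∈ Qcyl z₀ (rdy n) := ⟨hx, htm⟩
      have hl := h.lower _ hz
      have h0 : 0 ≤ ‖u (x, t)‖ ^ 2 + nsq2 (Dd (x, t)) := add_nonneg (sq_nonneg _) (nsq2_nonneg _)
      rw [mul_comm, ← ENNReal.ofReal_mul h0]
      exact ENNReal.ofReal_le_ofReal (mul_le_mul_of_nonneg_left hl h0)
    · rw [← lintegral_const_mul _ (by fun_prop)]
      refine le_trans ?_ (lintegral_mono_set (prod_mono hBn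
        (Ioo_subset_Ioo_left (by linarith : tb - 1 ≤ z₀.2 - rdy n ^ 2))))
      refine setLIntegral_mono' (Metric.isOpen_ball.prod isOpen_Ioo).measurableSet fun z hz => ?_
      have hz : z ∈ Qcyl z₀ (rdy n) := ⟨hz.1, hz.2.1, hz.2.2.trans htm.2⟩
      have hl := h.lower _ hz
      have h0 : 0 ≤ nsq2 (Du z) + nsq3 (D2d z) := add_nonneg (nsq2_nonneg _) (nsq3_nonneg _)
      rw [mul_comm, ← ENNReal.ofReal_mul h0]
      exact ENNReal.ofReal_le_ofReal (mul_le_mul_of_nonneg_left hl h0)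
  · refine (ENNReal.ofReal_le_ofReal (energy_integrand_le hq hC hρ (norm_nonneg (d z))
      (norm_nonneg (u z)) (nsq2_nonneg (Dd z)) h hz)).trans ?_
    refine ENNReal.ofReal_add_le.trans (add_le_add (ENNReal.ofReal_add_le.trans ?_) ?_)
    · rw [ENNReal.ofReal_mul hC.le]
    · refine (ENNReal.ofReal_sum_of_nonneg fun k _ => ?_).trans_le
        (Finset.sum_le_sum fun k _ => ?_)
      · exact indicator_nonneg (fun _ _ => mul_nonneg (hK0 k) (hF0 z)) _
      · by_cases hzk : z ∈ Qcyl z₀ (rdy k)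
        · simp only [hzk, indicator_of_mem]
          rw [ENNReal.ofReal_mul (hK0 k)]
        · simp [hzk]

theorem setLIntegral_prod_Ioo_le {B : Set E3} {a b : ℝ} (hab : a < b) {f : SpT → ℝ≥0∞}
    {D : ℝ≥0∞} (h : ∀ᵐ t ∂(volume.restrict (Ioo a b)), ∫⁻ z in B ×ˢ Ioo a t, f z ≤ D) :
    ∫⁻ z in B ×ˢ Ioo a b, f z ≤ D := by
  have hall : ∀ t < b, ∫⁻ z in B ×ˢ Ioo a t, f z ≤ D := by
    intro t ht
    have hmax : max a t < b := max_lt hab ht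
    have h2 := ae_restrict_of_ae_restrict_of_subset
      (Ioo_subset_Ioo_left (le_max_left a t) : Ioo (max a t) b ⊆ Ioo a b) h
    have hne : (ae (volume.restrict (Ioo (max a t) b))).NeBot := by
      rw [ae_restrict_neBot]
      simpa using hmax
    obtain ⟨s, hs, hsm⟩ := (h2.and (ae_restrict_mem measurableSet_Ioo)).exists
    refine le_trans (lintegral_mono_set (prod_mono_right (Ioo_subset_Ioo_right ?_))) hs
    exact (le_max_right a t).trans hsm.1.le
  have hU : B ×ˢ Ioo a b = ⋃ m : ℕ, B ×ˢ Ioo a (b - 1 / ((m : ℝ) + 1)) := by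
    ext z
    simp only [mem_prod, mem_Ioo, mem_iUnion]
    constructor
    · rintro ⟨h1, h2, h3⟩
      obtain ⟨m, hm⟩ := exists_nat_one_div_lt (sub_pos.2 h3)
      exact ⟨m, h1, h2, by linarith⟩
    · rintro ⟨m, h1, h2, h3⟩
      refine ⟨h1, h2, ?_⟩
      have : 0 < 1 / ((m : ℝ) + 1) := by positivity
      linarith
  rw [hU, setLIntegral_iUnion_of_directed]
  · refine iSup_le fun m => hall _ ?_
    have : 0 < 1 / ((m : ℝ) + 1) := by positivity
    linarith
  · refine Monotone.directed_le fun i j hij => prod_mono_right (Ioo_subset_Ioo_right ?_)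
    have := one_div_le_one_div_of_le (by positivity : (0 : ℝ) < i + 1)
      (by exact_mod_cast Nat.succ_le_succ hij : (i : ℝ) + 1 ≤ j + 1)
    linarith

theorem volume_ball3 (x : E3) {r : ℝ} (hr : 0 ≤ r) :
    volume (ball3 x r) = ENNReal.ofReal (r ^ 3) * volume (ball3 0 1) := by
  rw [ball3, ball3, Measure.addHaar_ball volume x hr]
  simp

theorem volume_Qcyl (z : SpT) {r : ℝ} (hr : 0 ≤ r) :
    volume (Qcyl z r) = ENNReal.ofReal (r ^ 5) * volume (ball3 0 1) := by
  rw [Qcyl, Measure.volume_eq_prod, Measure.prod_prod, volume_ball3 _ hr, Real.volume_Ioo,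
    mul_right_comm, ← ENNReal.ofReal_mul (by positivity)]
  congr 2
  ring

theorem volume_ball3_ne_zero : volume (ball3 0 1) ≠ 0 :=
  (Metric.measure_ball_pos volume _ one_pos).ne'

theorem volume_ball3_ne_top : volume (ball3 0 1) ≠ ∞ := measure_ball_lt_top.ne

theorem inv_volume_mul_le {c : ℝ} (hc : 0 < c) (x : E3) (n : ℕ) {X D : ℝ≥0∞}
    (h : ENNReal.ofReal (c * 8 ^ n) * X ≤ D) :
    (volume (ball3 x (rdy n)))⁻¹ * X ≤ (ENNReal.ofReal c * volume (ball3 0 1))⁻¹ * D := by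
  have hv0 := volume_ball3_ne_zero
  have hvt := volume_ball3_ne_top
  have hc0 : ENNReal.ofReal c ≠ 0 := by simpa using hc
  have e : (volume (ball3 x (rdy n)))⁻¹ =
      (ENNReal.ofReal c * volume (ball3 0 1))⁻¹ * ENNReal.ofReal (c * 8 ^ n) := by
    rw [volume_ball3 x (rdy_pos n).le, ENNReal.ofReal_mul hc.le,
      ENNReal.mul_inv (Or.inr hvt) (Or.inr hv0), ENNReal.mul_inv (Or.inr hvt) (Or.inr hv0),
      ← ENNReal.ofReal_inv_of_pos (by have := rdy_pos n; positivity), ← inv_pow, rdy_inv,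
      show ((2 : ℝ) ^ n) ^ 3 = 8 ^ n by rw [← pow_mul, mul_comm, pow_mul]; norm_num]
    calc ENNReal.ofReal (8 ^ n) * (volume (ball3 0 1))⁻¹ =
          ((ENNReal.ofReal c)⁻¹ * ENNReal.ofReal c) *
            (ENNReal.ofReal (8 ^ n) * (volume (ball3 0 1))⁻¹) := by
          rw [ENNReal.inv_mul_cancel hc0 ENNReal.ofReal_ne_top, one_mul]
      _ = _ := by ring
  rw [e, mul_assoc]
  gcongr

theorem Ldy_le_of_ae {u : SpT → E3} {Du Dd : SpT → Fin 3 → Fin 3 → ℝ}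
    {D2d : SpT → Fin 3 → Fin 3 → Fin 3 → ℝ} {z₀ : SpT} {n : ℕ} {c : ℝ} (hc : 0 < c) {D : ℝ≥0∞}
    (h : ∀ᵐ t ∂(volume.restrict (Ioo (z₀.2 - rdy n ^ 2) z₀.2)),
      ENNReal.ofReal (c * 8 ^ n) *
        ((∫⁻ x in ball3 z₀.1 (rdy n), ENNReal.ofReal (‖u (x, t)‖ ^ 2 + nsq2 (Dd (x, t)))) +
          ∫⁻ z in ball3 z₀.1 (rdy n) ×ˢ Ioo (z₀.2 - rdy n ^ 2) t,
            ENNReal.ofReal (nsq2 (Du z) + nsq3 (D2d z))) ≤ D) :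
    Ldy u Du Dd D2d z₀ n ≤ 2 * ((ENNReal.ofReal c * volume (ball3 0 1))⁻¹ * D) := by
  rw [two_mul]
  have h' := h.mono fun t ht => inv_volume_mul_le hc z₀.1 n ht
  refine add_le_add (essSup_le_of_ae_le _ (h'.mono fun t ht => ?_)) ?_
  · exact (mul_le_mul_right le_self_add _).trans ht
  · have hr := rdy_pos n
    set v := volume (ball3 z₀.1 (rdy n)) with hv
    have hv0 : v ≠ 0 := (Metric.measure_ball_pos volume _ hr).ne'
    have hvt : v ≠ ∞ := measure_ball_lt_top.ne
    rw [ENNReal.inv_mul_le_iff hv0 hvt]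
    refine setLIntegral_prod_Ioo_le (by nlinarith) (h'.mono fun t ht => ?_)
    exact (ENNReal.inv_mul_le_iff hv0 hvt).1 ((mul_le_mul_right le_add_self _).trans ht)

theorem mul_le_cube_add_rpow {a b : ℝ} (ha : 0 ≤ a) (hb : 0 ≤ b) :
    a * b ≤ a ^ 3 + b ^ ((3 : ℝ) / 2) := by
  have hpq : (3 : ℝ).HolderConjugate (3 / 2) := by
    rw [Real.holderConjugate_iff]; norm_num
  refine (Real.young_inequality_of_nonneg ha hb hpq).trans (add_le_add ?_ ?_)
  · rw [show a ^ (3 : ℝ) = a ^ 3 by norm_cast]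
    exact div_le_self (by positivity) (by norm_num)
  · exact div_le_self (by positivity) (by norm_num)

theorem sq_le_rpow_of_cube_le {a g : ℝ} (ha : 0 ≤ a) (h : a ^ 3 ≤ g) :
    a ^ 2 ≤ g ^ ((2 : ℝ) / 3) := by
  refine le_trans (le_of_eq ?_) (Real.rpow_le_rpow (by positivity) h (by norm_num))
  rw [← Real.rpow_natCast, ← Real.rpow_natCast, ← Real.rpow_mul ha]
  norm_num

theorem setLIntegral_rpow_two_thirds_le {Q : Set SpT} {g : SpT → ℝ≥0∞} (hg : Measurable g) :
    ∫⁻ z in Q, g z ^ ((2 : ℝ) / 3) ≤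
      (∫⁻ z in Q, g z) ^ ((2 : ℝ) / 3) * volume Q ^ ((1 : ℝ) / 3) := by
  have hpq : (3 / 2 : ℝ).HolderConjugate 3 := by
    rw [Real.holderConjugate_iff]; norm_num
  have := ENNReal.lintegral_mul_le_Lp_mul_Lq (volume.restrict Q) hpq
    (f := fun z => g z ^ ((2 : ℝ) / 3)) (g := fun _ => 1) (by fun_prop) (by fun_prop)
  simp only [Pi.mul_apply, mul_one, ← ENNReal.rpow_mul, ENNReal.one_rpow, lintegral_one,
    Measure.restrict_apply_univ] at this
  norm_num at this ⊢
  exact this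

theorem sum_rpow_neg_le {α : ℝ} (hα : 0 < α) (n : ℕ) :
    ∑ k ∈ Finset.Icc 1 n, (2 : ℝ) ^ (-α * k) ≤ ((2 : ℝ) ^ α - 1)⁻¹ := by
  have h1 : (1 : ℝ) < 2 ^ α := Real.one_lt_rpow (by norm_num) hα
  have hx0 : (0 : ℝ) < 2 ^ (-α) := by positivity
  have hx1 : (2 : ℝ) ^ (-α) < 1 := Real.rpow_lt_one_of_one_lt_of_neg (by norm_num) (by linarith)
  have e : ∀ k : ℕ, (2 : ℝ) ^ (-α * k) = (2 ^ (-α)) ^ k := fun k => by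
    rw [Real.rpow_mul (by norm_num), Real.rpow_natCast]
  simp only [e]
  have hs := (summable_geometric_of_lt_one hx0.le hx1)
  have h2 : ∑ k ∈ Finset.Icc 1 n, ((2 : ℝ) ^ (-α)) ^ k ≤ (1 - 2 ^ (-α))⁻¹ - 1 := by
    have h3 := hs.sum_le_tsum (Finset.range (n + 1)) (fun _ _ => by positivity)
    rw [tsum_geometric_of_lt_one hx0.le hx1, Finset.sum_range_succ'] at h3
    have h4 : ∑ k ∈ Finset.Icc 1 n, ((2 : ℝ) ^ (-α)) ^ k =
        ∑ k ∈ Finset.range n, ((2 : ℝ) ^ (-α)) ^ (k + 1) := by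
      rw [Finset.range_eq_Ico, Finset.sum_Ico_add' (fun k => ((2 : ℝ) ^ (-α)) ^ k)]
      rfl
    rw [h4]
    simp only [pow_zero] at h3
    linarith
  refine h2.trans_eq ?_
  rw [Real.rpow_neg (by norm_num)]
  have : (2 : ℝ) ^ α - 1 ≠ 0 := by linarith
  have : (2 : ℝ) ^ α ≠ 0 := by positivity
  field_simp
  ring

section Integrand

variable {xb : E3} {tb : ℝ} {u d : SpT → E3} {p : SpT → ℝ}
  {Du Dd : SpT → Fin 3 → Fin 3 → ℝ} {D2d : SpT → Fin 3 → Fin 3 → Fin 3 → ℝ} {q : ℝ}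

/-- The integrand of `E3q`. -/
def e3qIntegrand (u d : SpT → E3) (p : SpT → ℝ) (Dd : SpT → Fin 3 → Fin 3 → ℝ) (q : ℝ)
    (z : SpT) : ℝ :=
  ‖u z‖ ^ 3 + Real.sqrt (nsq2 (Dd z)) ^ 3 + |p z| ^ ((3 : ℝ) / 2) +
    ‖d z‖ ^ q * Real.sqrt (nsq2 (Dd z)) ^ (3 * (1 - q / 6))

theorem QReg.measurable_e3qIntegrand (h : QReg xb tb u d p Du Dd D2d) :
    Measurable (e3qIntegrand u d p Dd q) := by
  have := h.meas_u
  have := h.meas_d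
  have := h.meas_p
  have : Measurable fun z => nsq2 (Dd z) := measurable_nsq2.comp h.meas_Dd
  unfold e3qIntegrand
  fun_prop

theorem cubes_le_e3qIntegrand (z : SpT) :
    ‖u z‖ ^ 3 + Real.sqrt (nsq2 (Dd z)) ^ 3 ≤ e3qIntegrand u d p Dd q z := by
  have : 0 ≤ |p z| ^ ((3 : ℝ) / 2) := by positivity
  have : 0 ≤ ‖d z‖ ^ q * Real.sqrt (nsq2 (Dd z)) ^ (3 * (1 - q / 6)) := by positivity
  unfold e3qIntegrand
  linarith

theorem coupling_le_e3qIntegrand (z : SpT) :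
    ‖d z‖ ^ q * Real.sqrt (nsq2 (Dd z)) ^ (3 * (1 - q / 6)) ≤ e3qIntegrand u d p Dd q z := by
  unfold e3qIntegrand
  have : 0 ≤ ‖u z‖ ^ 3 + Real.sqrt (nsq2 (Dd z)) ^ 3 + |p z| ^ ((3 : ℝ) / 2) := by positivity
  linarith

theorem pressure_le_e3qIntegrand (z : SpT) : ‖u z‖ * |p z| ≤ e3qIntegrand u d p Dd q z := by
  refine (mul_le_cube_add_rpow (norm_nonneg _) (abs_nonneg _)).trans ?_
  have : 0 ≤ Real.sqrt (nsq2 (Dd z)) ^ 3 := by positivity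
  have : 0 ≤ ‖d z‖ ^ q * Real.sqrt (nsq2 (Dd z)) ^ (3 * (1 - q / 6)) := by positivity
  unfold e3qIntegrand
  linarith

theorem e3qIntegrand_nonneg (z : SpT) : 0 ≤ e3qIntegrand u d p Dd q z :=
  (by positivity : 0 ≤ ‖u z‖ * |p z|).trans (pressure_le_e3qIntegrand z)

theorem energy_le_e3qIntegrand (z : SpT) :
    ‖u z‖ ^ 2 + nsq2 (Dd z) ≤ 2 * e3qIntegrand u d p Dd q z ^ ((2 : ℝ) / 3) := by
  have h := cubes_le_e3qIntegrand (u := u) (d := d) (p := p) (Dd := Dd) (q := q) z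
  have h1 : 0 ≤ ‖u z‖ ^ 3 := by positivity
  have h2 : 0 ≤ Real.sqrt (nsq2 (Dd z)) ^ 3 := by positivity
  have h3 := sq_le_rpow_of_cube_le (norm_nonneg (u z)) (le_of_add_le_of_nonneg_left h h2)
  have h4 := sq_le_rpow_of_cube_le (Real.sqrt_nonneg (nsq2 (Dd z)))
    (le_of_add_le_of_nonneg_right h h1)
  rw [Real.sq_sqrt (nsq2_nonneg _)] at h4
  linarith

theorem E3q_eq : E3q xb tb u d p Dd q =
    ∫⁻ z in Qcyl (xb, tb) 1, ENNReal.ofReal (e3qIntegrand u d p Dd q z) := rfl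

theorem setLIntegral_le_E3q {f : SpT → ℝ} (hf : ∀ z, f z ≤ e3qIntegrand u d p Dd q z) {s : Set SpT}
    (hs : s ⊆ Qcyl (xb, tb) 1) :
    ∫⁻ z in s, ENNReal.ofReal (f z) ≤ E3q xb tb u d p Dd q :=
  (lintegral_mono_set hs).trans (lintegral_mono fun z => ENNReal.ofReal_le_ofReal (hf z))

theorem setLIntegral_energy_le (h : QReg xb tb u d p Du Dd D2d) :
    ∫⁻ z in Qcyl (xb, tb) 1, ENNReal.ofReal (‖u z‖ ^ 2 + nsq2 (Dd z)) ≤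
      2 * (E3q xb tb u d p Dd q ^ ((2 : ℝ) / 3) * volume (ball3 0 1) ^ ((1 : ℝ) / 3)) := by
  have hv : volume (Qcyl (xb, tb) 1) = volume (ball3 0 1) := by
    rw [volume_Qcyl _ zero_le_one]; simp
  have hm : Measurable fun z => ENNReal.ofReal (e3qIntegrand u d p Dd q z) :=
    h.measurable_e3qIntegrand.ennreal_ofReal
  rw [← hv, E3q_eq]
  refine le_trans ?_ (mul_le_mul_right (setLIntegral_rpow_two_thirds_le hm) _)
  rw [← lintegral_const_mul _ (by fun_prop)]
  refine lintegral_mono fun z => (ENNReal.ofReal_le_ofReal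
    (energy_le_e3qIntegrand (d := d) (p := p) (q := q) z)).trans_eq ?_
  rw [ENNReal.ofReal_mul (by norm_num),
    ENNReal.ofReal_rpow_of_nonneg (e3qIntegrand_nonneg z) (by norm_num)]
  simp

theorem QReg.integrableOn_of_le (h : QReg xb tb u d p Du Dd D2d) (hE : E3q xb tb u d p Dd q ≠ ∞)
    {F : Type*} [NormedAddCommGroup F] {f : SpT → F}
    (hfm : AEStronglyMeasurable f)
    (hf : ∀ z, ‖f z‖ ≤ 2 + 2 * e3qIntegrand u d p Dd q z) :
    IntegrableOn f (Qcyl (xb, tb) 1) := by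
  have hfin : volume (Qcyl (xb, tb) 1) ≠ ∞ := by
    rw [volume_Qcyl _ zero_le_one]
    simpa using volume_ball3_ne_top
  have hg : IntegrableOn (e3qIntegrand u d p Dd q) (Qcyl (xb, tb) 1) := by
    refine ⟨h.measurable_e3qIntegrand.aestronglyMeasurable, ?_⟩
    rw [hasFiniteIntegral_iff_ofReal (Eventually.of_forall e3qIntegrand_nonneg)]
    exact hE.lt_top
  exact Integrable.mono' ((integrableOn_const hfin).add (hg.const_mul 2)) hfm.restrict
    (Eventually.of_forall hf)

end Integrand

theorem sq_le_one_add_cube {a : ℝ} (ha : 0 ≤ a) : a ^ 2 ≤ 1 + a ^ 3 := by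
  rcases le_total a 1 with h | h
  · nlinarith [pow_nonneg ha 3]
  · nlinarith [mul_nonneg (sq_nonneg a) (sub_nonneg.2 h)]

/-- The pressure average subtracted on the `k`-th cylinder, for `k` at least `k₀`. -/
def pressureShift (p : SpT → ℝ) (z₀ : SpT) (k₀ k : ℕ) (t : ℝ) : ℝ :=
  if k < k₀ then 0 else ⨍ x in ball3 z₀.1 (rdy k), p (x, t)

theorem measurable_pressureShift {p : SpT → ℝ} (hp : Measurable p) (z₀ : SpT) (k₀ k : ℕ) :
    Measurable (pressureShift p z₀ k₀ k) := by
  unfold pressureShift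
  split_ifs
  · exact measurable_const
  · simp only [setAverage_eq, smul_eq_mul]
    exact (hp.stronglyMeasurable.integral_prod_left').measurable.const_mul _

theorem inner_term_le {u : SpT → E3} {p : SpT → ℝ} {Dd : SpT → Fin 3 → Fin 3 → ℝ} {z₀ : SpT}
    {q C : ℝ} (hq : q ∈ Ioc (5 : ℝ) 6) (hC : 0 < C) (k : ℕ) :
    ENNReal.ofReal ((3 * C + (1 + C) ^ 2) * 2 ^ (3 * q / (q - 2) * k)) *
          (∫⁻ z in Qcyl z₀ (rdy k), ENNReal.ofReal (‖u z‖ ^ 3 + Real.sqrt (nsq2 (Dd z)) ^ 3)) +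
        ENNReal.ofReal (3 * C * 16 ^ k) * (∫⁻ z in Qcyl z₀ (rdy k),
          ENNReal.ofReal (‖u z‖ * |p z - ⨍ x in ball3 z₀.1 (rdy k), p (x, z.2)|)) ≤
      ENNReal.ofReal (3 * C + (1 + C) ^ 2) * volume (ball3 0 1) *
        (ENNReal.ofReal (2 ^ (-(2 * (q - 5) / (q - 2)) * k)) * Rdy u p Dd z₀ k) := by
  set K := 3 * C + (1 + C) ^ 2 with hK
  have hK0 : 0 ≤ K := by positivity
  have hr := rdy_pos k
  set V := volume (Qcyl z₀ (rdy k)) with hV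
  have hVe : V = ENNReal.ofReal (rdy k ^ 5) * volume (ball3 0 1) := volume_Qcyl _ hr.le
  have hV0 : V ≠ 0 := by
    rw [hVe]
    exact mul_ne_zero (by simpa using by positivity) volume_ball3_ne_zero
  have hVt : V ≠ ∞ := by
    rw [hVe]
    exact ENNReal.mul_ne_top ENNReal.ofReal_ne_top volume_ball3_ne_top
  have hq2 : q - 2 ≠ 0 := by linarith [hq.1]
  have hr2 : rdy k = 2 ^ (-(k : ℝ)) := by
    rw [Real.rpow_neg (by norm_num), Real.rpow_natCast, ← rdy_inv, inv_inv]
  have hW : (2 : ℝ) ^ (-(2 * (q - 5) / (q - 2)) * k) = 2 ^ (3 * q / (q - 2) * k) * rdy k ^ 5 := by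
    rw [hr2, ← Real.rpow_natCast, ← Real.rpow_mul (by norm_num), ← Real.rpow_add (by norm_num)]
    congr 1
    push_cast
    field_simp
    ring
  have h16 : 3 * C * 16 ^ k ≤ K * 2 ^ (3 * q / (q - 2) * k) * rdy k ^ ((1 : ℝ) / 3) := by
    have e : (16 : ℝ) ^ k = 16 ^ k * 2 ^ ((k : ℝ) / 3) * rdy k ^ ((1 : ℝ) / 3) := by
      rw [hr2, ← Real.rpow_mul (by norm_num), mul_assoc, ← Real.rpow_add (by norm_num)]
      ring_nf
      simp
    rw [e, ← mul_assoc]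
    refine mul_le_mul_of_nonneg_right ?_ (by positivity)
    refine mul_le_mul ?_ (sixteen_mul_rpow_le hq k) (by positivity) hK0
    rw [hK]
    linarith [sq_nonneg (1 + C)]
  have hKW : 0 ≤ K * 2 ^ (3 * q / (q - 2) * k) := by positivity
  set X := ∫⁻ z in Qcyl z₀ (rdy k), ENNReal.ofReal (‖u z‖ ^ 3 + Real.sqrt (nsq2 (Dd z)) ^ 3)
    with hX
  set Y := ∫⁻ z in Qcyl z₀ (rdy k),
    ENNReal.ofReal (‖u z‖ * |p z - ⨍ x in ball3 z₀.1 (rdy k), p (x, z.2)|) with hY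
  have hR : V * Rdy u p Dd z₀ k = X + ENNReal.ofReal (rdy k ^ ((1 : ℝ) / 3)) * Y := by
    rw [Rdy, lintegral_add_right _ measurable_const, setLIntegral_const, ← mul_assoc,
      ENNReal.mul_inv_cancel hV0 hVt, one_mul, mul_comm V⁻¹, ← mul_assoc, mul_assoc _ V⁻¹,
      ENNReal.inv_mul_cancel hV0 hVt, mul_one]
  calc _ ≤ ENNReal.ofReal (K * 2 ^ (3 * q / (q - 2) * k)) * X +
        ENNReal.ofReal (K * 2 ^ (3 * q / (q - 2) * k) * rdy k ^ ((1 : ℝ) / 3)) * Y := by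
        gcongr
    _ = ENNReal.ofReal (K * 2 ^ (3 * q / (q - 2) * k)) * (V * Rdy u p Dd z₀ k) := by
        rw [hR, ENNReal.ofReal_mul hKW, mul_add, mul_assoc]
    _ = _ := by
        rw [hW, hVe, ENNReal.ofReal_mul hK0, ENNReal.ofReal_mul (by positivity)]
        ring

theorem outer_term_le {xb : E3} {tb : ℝ} {u d : SpT → E3} {p : SpT → ℝ}
    {Dd : SpT → Fin 3 → Fin 3 → ℝ} {z₀ : SpT} (hz₀ : z₀ ∈ Qcyl (xb, tb) (1 / 2))
    {q C : ℝ} (hq : q ∈ Ioc (5 : ℝ) 6) (hC : 0 < C) {k k₀ : ℕ} (hk : 1 ≤ k) (hk₀ : k < k₀) :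
    ENNReal.ofReal ((3 * C + (1 + C) ^ 2) * 2 ^ (3 * q / (q - 2) * k)) *
          (∫⁻ z in Qcyl z₀ (rdy k), ENNReal.ofReal (‖u z‖ ^ 3 + Real.sqrt (nsq2 (Dd z)) ^ 3)) +
        ENNReal.ofReal (3 * C * 16 ^ k) *
          (∫⁻ z in Qcyl z₀ (rdy k), ENNReal.ofReal (‖u z‖ * |p z|)) ≤
      2 * ENNReal.ofReal (3 * C + (1 + C) ^ 2) * 2 ^ (5 * k₀) * E3q xb tb u d p Dd q := by
  set K := 3 * C + (1 + C) ^ 2 with hK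
  have hK0 : 0 ≤ K := by positivity
  have hsub := Qcyl_rdy_subset hz₀ hk
  have h32 : (32 : ℝ) ^ k ≤ 32 ^ k₀ := pow_le_pow_right₀ (by norm_num) hk₀.le
  have e : ENNReal.ofReal (K * 32 ^ k₀) = ENNReal.ofReal K * 2 ^ (5 * k₀) := by
    rw [ENNReal.ofReal_mul hK0, ENNReal.ofReal_pow (by norm_num), pow_mul]
    norm_num
  have h1 : ENNReal.ofReal (K * 2 ^ (3 * q / (q - 2) * k)) ≤ ENNReal.ofReal K * 2 ^ (5 * k₀) := by
    rw [← e]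
    refine ENNReal.ofReal_le_ofReal (mul_le_mul_of_nonneg_left ?_ hK0)
    exact (rpow_le_thirtytwo hq k).trans h32
  have h2 : ENNReal.ofReal (3 * C * 16 ^ k) ≤ ENNReal.ofReal K * 2 ^ (5 * k₀) := by
    rw [← e]
    refine ENNReal.ofReal_le_ofReal (mul_le_mul ?_ ?_ (by positivity) hK0)
    · rw [hK]
      linarith [sq_nonneg (1 + C)]
    · exact (pow_le_pow_left₀ (by norm_num) (by norm_num) k).trans h32
  have i1 := setLIntegral_le_E3q (fun z => cubes_le_e3qIntegrand (u := u) (d := d) (p := p)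
    (Dd := Dd) (q := q) z) hsub
  have i2 := setLIntegral_le_E3q (fun z => pressure_le_e3qIntegrand (u := u) (d := d) (p := p)
    (Dd := Dd) (q := q) z) hsub
  refine (add_le_add (mul_le_mul' h1 i1) (mul_le_mul' h2 i2)).trans_eq ?_
  ring

theorem dyadicBound_le {xb : E3} {tb : ℝ} {u d : SpT → E3} {p : SpT → ℝ}
    {Du Dd : SpT → Fin 3 → Fin 3 → ℝ} {D2d : SpT → Fin 3 → Fin 3 → Fin 3 → ℝ}
    (hreg : QReg xb tb u d p Du Dd D2d) {z₀ : SpT} (hz₀ : z₀ ∈ Qcyl (xb, tb) (1 / 2))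
    {q C : ℝ} (hq : q ∈ Ioc (5 : ℝ) 6) (hC : 0 < C) (n k₀ : ℕ) :
    dyadicBound xb tb u d p Dd z₀ q n C (pressureShift p z₀ k₀) ≤
      (ENNReal.ofReal C * (2 * volume (ball3 0 1) ^ ((1 : ℝ) / 3)) + 1 +
        ENNReal.ofReal (3 * C + (1 + C) ^ 2) * (volume (ball3 0 1) + 2)) *
      (ENNReal.ofReal (((2 : ℝ) ^ (2 * (q - 5) / (q - 2)) - 1)⁻¹) *
            (⨆ k ∈ Icc k₀ n, Rdy u p Dd z₀ k) +
          E3q xb tb u d p Dd q ^ ((2 : ℝ) / 3) +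
          (1 + (k₀ : ℝ≥0∞) * 2 ^ (5 * k₀)) * E3q xb tb u d p Dd q) := by
  set α := 2 * (q - 5) / (q - 2) with hα
  have hα0 : 0 < α := div_pos (by linarith [hq.1]) (by linarith [hq.1])
  set K := ENNReal.ofReal (3 * C + (1 + C) ^ 2) with hK
  set E := E3q xb tb u d p Dd q with hE
  set v := volume (ball3 0 1) with hv
  set M := ⨆ k ∈ Icc k₀ n, Rdy u p Dd z₀ k with hM
  set S := ENNReal.ofReal ((2 ^ α - 1)⁻¹) with hS
  have t1 := setLIntegral_energy_le (q := q) hreg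
  have t2 := setLIntegral_le_E3q (fun z => coupling_le_e3qIntegrand (u := u) (d := d) (p := p)
    (Dd := Dd) (q := q) z) (Subset.rfl : Qcyl (xb, tb) 1 ⊆ Qcyl (xb, tb) 1)
  have t3 : ∑ k ∈ Finset.Icc 1 n,
      (ENNReal.ofReal ((3 * C + (1 + C) ^ 2) * 2 ^ (3 * q / (q - 2) * k)) *
          (∫⁻ z in Qcyl z₀ (rdy k), ENNReal.ofReal (‖u z‖ ^ 3 + Real.sqrt (nsq2 (Dd z)) ^ 3)) +
        ENNReal.ofReal (3 * C * 16 ^ k) * ∫⁻ z in Qcyl z₀ (rdy k),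
          ENNReal.ofReal (‖u z‖ * |p z - pressureShift p z₀ k₀ k z.2|)) ≤
      k₀ * (2 * K * 2 ^ (5 * k₀) * E) + K * v * (S * M) := by
    calc _ ≤ ∑ k ∈ Finset.Icc 1 n, ((if k < k₀ then 2 * K * 2 ^ (5 * k₀) * E else 0) +
          K * v * (ENNReal.ofReal (2 ^ (-α * k)) * M)) := by
          refine Finset.sum_le_sum fun k hk => ?_
          obtain ⟨hk1, hkn⟩ := Finset.mem_Icc.1 hk
          by_cases hlt : k < k₀
          · simp only [pressureShift, hlt, if_true, sub_zero]
            exact (outer_term_le hz₀ hq hC hk1 hlt).trans le_self_add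
          · simp only [pressureShift, hlt, if_false, zero_add]
            refine (inner_term_le hq hC k).trans ?_
            gcongr
            exact le_iSup₂_of_le k ⟨not_lt.1 hlt, hkn⟩ le_rfl
      _ ≤ _ := by
          rw [Finset.sum_add_distrib, ← Finset.mul_sum, ← Finset.sum_mul]
          gcongr
          · rw [← Finset.sum_filter, Finset.sum_const, nsmul_eq_mul]
            gcongr
            refine (Finset.card_le_card (t := Finset.range k₀) fun k hk => ?_).trans_eq (by simp)
            exact Finset.mem_range.2 (Finset.mem_filter.1 hk).2
          · rw [← ENNReal.ofReal_sum_of_nonneg fun _ _ => by positivity]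
            exact ENNReal.ofReal_le_ofReal (sum_rpow_neg_le hα0 n)
  refine (add_le_add (add_le_add (mul_le_mul_right t1 _) t2) t3).trans ?_
  set a := ENNReal.ofReal C * (2 * v ^ ((1 : ℝ) / 3)) with ha
  set X := E ^ ((2 : ℝ) / 3)
  set N := (k₀ : ℝ≥0∞) * 2 ^ (5 * k₀) with hN
  calc ENNReal.ofReal C * (2 * (X * v ^ ((1 : ℝ) / 3))) + E +
        (k₀ * (2 * K * 2 ^ (5 * k₀) * E) + K * v * (S * M)) =
        a * X + 1 * E + (K * 2 * (N * E) + K * v * (S * M)) := by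
        rw [ha, hN]; ring
    _ ≤ a * X + 1 * E + (K * 2 * (N * E) + K * v * (S * M)) +
        (a * (S * M + (1 + N) * E) + 1 * (S * M + X + N * E) + K * v * (X + (1 + N) * E) +
          K * 2 * (S * M + X + E)) := le_self_add
    _ = _ := by ring

/-- Proposition `lb`: for each `C̄ > 0` there is `C_B > 0` depending only on `C̄` with
`L_n(z₀) ≤ C_B ((2^{α_q}−1)⁻¹ max_{k₀≤k≤n} R_k(z₀) + E_{3,q}^{2/3} + (1 + k₀ 2^{5k₀}) E_{3,q})`. -/
theorem stmt4 (Cb : ℝ) (hCb : 0 < Cb) :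
    ∃ CB : ℝ, 0 < CB ∧
      ∀ (xb : E3) (tb ρb : ℝ), ρb ∈ Ioc (0 : ℝ) 1 →
      ∀ (u d : SpT → E3) (p : SpT → ℝ) (Du Dd : SpT → Fin 3 → Fin 3 → ℝ)
        (D2d : SpT → Fin 3 → Fin 3 → Fin 3 → ℝ),
      QReg xb tb u d p Du Dd D2d →
      DivFreeOn (Qcyl (xb, tb) 1) u →
      LocalEnergyQ xb tb Cb ρb u d p Du Dd D2d →
      ∀ z₀ ∈ Qcyl (xb, tb) (1 / 2), ∀ q : ℝ, q ∈ Ioc (5 : ℝ) 6 →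
      ∀ n : ℕ, 2 ≤ n → ∀ k₀ : ℕ, k₀ ∈ Icc 1 (n - 1) →
      Ldy u Du Dd D2d z₀ n ≤ ENNReal.ofReal CB *
        (ENNReal.ofReal (((2 : ℝ) ^ (2 * (q - 5) / (q - 2)) - 1)⁻¹) *
            (⨆ k ∈ Icc k₀ n, Rdy u p Dd z₀ k) +
          E3q xb tb u d p Dd q ^ ((2 : ℝ) / 3) +
          (1 + (k₀ : ℝ≥0∞) * 2 ^ (5 * k₀)) * E3q xb tb u d p Dd q) := by
  obtain ⟨C, hC, c, hc, htest⟩ := exists_isHeatTest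
  have hcv : (ENNReal.ofReal c * volume (ball3 0 1))⁻¹ ≠ ∞ :=
    ENNReal.inv_ne_top.2 (mul_ne_zero (by simpa using hc) volume_ball3_ne_zero)
  set W : ℝ≥0∞ := ENNReal.ofReal C * (2 * volume (ball3 0 1) ^ ((1 : ℝ) / 3)) + 1 +
    ENNReal.ofReal (3 * C + (1 + C) ^ 2) * (volume (ball3 0 1) + 2) with hW
  have hWt : W ≠ ∞ := by
    have hv := volume_ball3_ne_top
    have hv3 := ENNReal.rpow_ne_top_of_nonneg (y := (1 : ℝ) / 3) (by norm_num) hv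
    finiteness
  set A : ℝ≥0∞ := 2 * ((ENNReal.ofReal c * volume (ball3 0 1))⁻¹ * (ENNReal.ofReal Cb * W))
    with hA
  have hAt : A ≠ ∞ := by finiteness
  have hAC : A ≤ ENNReal.ofReal (A.toReal + 1) := by
    rw [ENNReal.ofReal_add ENNReal.toReal_nonneg zero_le_one, ENNReal.ofReal_toReal hAt]
    exact le_self_add
  refine ⟨A.toReal + 1, by positivity, ?_⟩
  intro xb tb ρb hρ u d p Du Dd D2d hreg hdiv hle z₀ hz₀ q hq n hn k₀ _
  by_cases hE : E3q xb tb u d p Dd q = ∞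
  · have h0 : ENNReal.ofReal (A.toReal + 1) ≠ 0 := by
      simpa using by positivity
    simp [hE, ENNReal.mul_top, h0]
  have hcube : ∀ z, ‖u z‖ ^ 3 + Real.sqrt (nsq2 (Dd z)) ^ 3 ≤ e3qIntegrand u d p Dd q z :=
    cubes_le_e3qIntegrand
  have hu0 : ∀ z, 0 ≤ ‖u z‖ := fun z => norm_nonneg _
  have hs0 : ∀ z, 0 ≤ Real.sqrt (nsq2 (Dd z)) := fun z => Real.sqrt_nonneg _
  have hnD : Measurable fun z => nsq2 (Dd z) := measurable_nsq2.comp hreg.meas_Dd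
  have hui : IntegrableOn u (Qcyl (xb, tb) 1) := by
    refine hreg.integrableOn_of_le hE hreg.meas_u.aestronglyMeasurable fun z => ?_
    have h1 := sq_le_one_add_cube (hu0 z)
    nlinarith [hcube z, sq_nonneg (‖u z‖ - 1), pow_nonneg (hu0 z) 3, pow_nonneg (hs0 z) 3]
  have hpu : IntegrableOn (fun z => |p z| * ‖u z‖) (Qcyl (xb, tb) 1) := by
    refine hreg.integrableOn_of_le hE
      (hreg.meas_p.abs.mul hreg.meas_u.norm).aestronglyMeasurable fun z => ?_
    rw [Real.norm_of_nonneg (by positivity), mul_comm]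
    linarith [pressure_le_e3qIntegrand (u := u) (d := d) (p := p) (Dd := Dd) (q := q) z,
      e3qIntegrand_nonneg (u := u) (d := d) (p := p) (Dd := Dd) (q := q) z]
  have heu : IntegrableOn (fun z => ‖u z‖ ^ 2 + nsq2 (Dd z)) (Qcyl (xb, tb) 1) := by
    refine hreg.integrableOn_of_le hE
      ((hreg.meas_u.norm.pow_const 2).add hnD).aestronglyMeasurable fun z => ?_
    rw [Real.norm_of_nonneg (add_nonneg (sq_nonneg _) (nsq2_nonneg _))]
    have h1 := sq_le_one_add_cube (hu0 z)
    have h2 := sq_le_one_add_cube (hs0 z)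
    rw [Real.sq_sqrt (nsq2_nonneg _)] at h2
    linarith [hcube z, e3qIntegrand_nonneg (u := u) (d := d) (p := p) (Dd := Dd) (q := q) z]
  obtain ⟨φ, η, hφ⟩ := htest z₀ n hn
  have hL := Ldy_le_of_ae hc (ae_energy_le_dyadicBound hCb.le hρ hreg hdiv hle hui hpu heu hz₀ hq
    hC (one_le_two.trans hn) hφ (pressureShift p z₀ k₀)
    fun k => measurable_pressureShift hreg.meas_p z₀ k₀ k)
  refine (hL.trans ?_).trans (mul_le_mul_left hAC _)
  calc _ ≤ 2 * ((ENNReal.ofReal c * volume (ball3 0 1))⁻¹ * (ENNReal.ofReal Cb * (W * _))) := by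
        gcongr
        exact dyadicBound_le hreg hz₀ hq hC n k₀
    _ = _ := by
        rw [hA]
        ring
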